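/- arXiv:1209.4889 — 2 statements merged into one kernel-verified Lean document; each statement's English description precedes it below -/
import Mathlib

section
/- Among all subsets of N that are weakly decodable there is a unique largest one: there exists a weakly decodable subset D' ⊆ N containing every weakly decodable subset of N. -/
open scoped BigOperators

/-- Shannon entropy (natural log) of a random variable `X` on a finite sample
space `Ω` with probability mass function `μ`. -/
noncomputable def entropy {Ω α : Type*} [Fintype Ω] [Fintype α] [DecidableEq α]
    (μ : Ω → ℝ) (X : Ω → α) : ℝ :=
  ∑ a : α, Real.negMulLog (∑ ω ∈ Finset.univ.filter (fun ω => X ω = a), μ ω)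

/-- Conditional mutual information `I(X;Y|Z)` for random variables on a finite
sample space with pmf `μ`. -/
noncomputable def condMI {Ω α β γ : Type*} [Fintype Ω]
    [Fintype α] [DecidableEq α] [Fintype β] [DecidableEq β] [Fintype γ] [DecidableEq γ]
    (μ : Ω → ℝ) (X : Ω → α) (Y : Ω → β) (Z : Ω → γ) : ℝ :=
  entropy μ (fun ω => (X ω, Z ω)) + entropy μ (fun ω => (Y ω, Z ω))
    - entropy μ (fun ω => (X ω, Y ω, Z ω)) - entropy μ Z

/-- Sample space for the compress-and-forward multiple-relay channel:
a value of `(x₀, (xᵢ)ᵢ, (yᵢ)ᵢ, y_{n+1}, (ŷᵢ)ᵢ)`. -/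
abbrev CFOmega {n : ℕ} (X0A : Type) (XA YA : Fin n → Type) (YdA : Type)
    (YhA : Fin n → Type) : Type :=
  X0A × (∀ i, XA i) × (∀ i, YA i) × YdA × (∀ i, YhA i)

section CF

variable {n : ℕ} {X0A YdA : Type} {XA YA YhA : Fin n → Type}

/-- The source input `X₀`. -/
def rvX0 : CFOmega X0A XA YA YdA YhA → X0A := fun ω => ω.1

/-- The tuple of relay inputs `X_S = (Xᵢ)_{i∈S}`. -/
def rvXS (S : Finset (Fin n)) : CFOmega X0A XA YA YdA YhA → (∀ i : S, XA i) :=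
  fun ω i => ω.2.1 i

/-- The tuple of relay outputs `Y_S = (Yᵢ)_{i∈S}`. -/
def rvYS (S : Finset (Fin n)) : CFOmega X0A XA YA YdA YhA → (∀ i : S, YA i) :=
  fun ω i => ω.2.2.1 i

/-- The destination output `Y_{n+1}`. -/
def rvYd : CFOmega X0A XA YA YdA YhA → YdA := fun ω => ω.2.2.2.1

/-- The tuple of compressions `Ŷ_S = (Ŷᵢ)_{i∈S}`. -/
def rvYhS (S : Finset (Fin n)) : CFOmega X0A XA YA YdA YhA → (∀ i : S, YhA i) :=
  fun ω i => ω.2.2.2.2 i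

/-- The joint pmf
`p(x₀)·∏ᵢ p(xᵢ) · p(y₁,…,y_{n+1}|x₀,…,x_n) · ∏ᵢ p(ŷᵢ|yᵢ,xᵢ)`. -/
noncomputable def muCF (p0 : X0A → ℝ) (pX : ∀ i, XA i → ℝ)
    (W : X0A → (∀ i, XA i) → ((∀ i, YA i) × YdA) → ℝ)
    (κ : ∀ i, YA i → XA i → YhA i → ℝ) :
    CFOmega X0A XA YA YdA YhA → ℝ :=
  fun ω => p0 ω.1 * (∏ i, pX i (ω.2.1 i)) * W ω.1 ω.2.1 (ω.2.2.1, ω.2.2.2.1)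
    * ∏ i, κ i (ω.2.2.1 i) (ω.2.1 i) (ω.2.2.2.2 i)

variable [Fintype X0A] [DecidableEq X0A] [Fintype YdA] [DecidableEq YdA]
  [∀ i, Fintype (XA i)] [∀ i, DecidableEq (XA i)]
  [∀ i, Fintype (YA i)] [∀ i, DecidableEq (YA i)]
  [∀ i, Fintype (YhA i)] [∀ i, DecidableEq (YhA i)]

/-- `I(X_S; Ŷ_{D∖S}, Y_{n+1} | X_0, X_{D∖S}) − I(Y_S; Ŷ_S | X_0, X_D, Y_{n+1}, Ŷ_{D∖S})`. -/
noncomputable def cfGap (μ : CFOmega X0A XA YA YdA YhA → ℝ) (D S : Finset (Fin n)) : ℝ :=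
  condMI μ (rvXS S) (fun ω => (rvYhS (D \ S) ω, rvYd ω))
    (fun ω => (rvX0 ω, rvXS (D \ S) ω))
  - condMI μ (rvYS S) (rvYhS S)
    (fun ω => (rvX0 ω, rvXS D ω, rvYd ω, rvYhS (D \ S) ω))

/-- `D ⊆ N` is weakly decodable if for every `S ⊆ D`,
`I(X_S; Ŷ_{D∖S}, Y_{n+1} | X_0, X_{D∖S}) − I(Y_S; Ŷ_S | X_0, X_D, Y_{n+1}, Ŷ_{D∖S}) ≥ 0`. -/
def WeaklyDecodable (μ : CFOmega X0A XA YA YdA YhA → ℝ) (D : Finset (Fin n)) : Prop :=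
  ∀ S ⊆ D, 0 ≤ cfGap μ D S

/-- `D ⊆ N` is strictly decodable if for every nonempty `S ⊆ D`,
`I(X_S; Ŷ_{D∖S}, Y_{n+1} | X_0, X_{D∖S}) − I(Y_S; Ŷ_S | X_0, X_D, Y_{n+1}, Ŷ_{D∖S}) > 0`. -/
def StrictlyDecodable (μ : CFOmega X0A XA YA YdA YhA → ℝ) (D : Finset (Fin n)) : Prop :=
  ∀ S ⊆ D, S.Nonempty → 0 < cfGap μ D S

/-- `G(T) = min_{S ⊆ T} [ I(X_0, X_S; Ŷ_{T∖S}, Y_{n+1} | X_{T∖S})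
  − I(Y_S; Ŷ_S | X_0, X_T, Y_{n+1}, Ŷ_{T∖S}) ]`. -/
noncomputable def Gfun (μ : CFOmega X0A XA YA YdA YhA → ℝ) (T : Finset (Fin n)) : ℝ :=
  T.powerset.inf' (Finset.powerset_nonempty T) fun S =>
    condMI μ (fun ω => (rvX0 ω, rvXS S ω)) (fun ω => (rvYhS (T \ S) ω, rvYd ω))
      (rvXS (T \ S))
    - condMI μ (rvYS S) (rvYhS S)
      (fun ω => (rvX0 ω, rvXS T ω, rvYd ω, rvYhS (T \ S) ω))

end CF

section Entropy

variable {Ω α β γ : Type*} [Fintype Ω] [DecidableEq α] [DecidableEq β] [DecidableEq γ]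

/-- The mass, under `μ`, of the fibre of `X` through `ω`. -/
def fiberMass (μ : Ω → ℝ) (X : Ω → α) (ω : Ω) : ℝ :=
  ∑ ω' ∈ Finset.univ.filter (fun ω' => X ω' = X ω), μ ω'

lemma fiberMass_pos {μ : Ω → ℝ} (hμ : ∀ ω, 0 ≤ μ ω) (X : Ω → α) {ω : Ω} (h : μ ω ≠ 0) :
    0 < fiberMass μ X ω :=
  lt_of_lt_of_le (lt_of_le_of_ne (hμ ω) h.symm)
    (Finset.single_le_sum (f := μ) (fun ω' _ => hμ ω') (by simp))

lemma entropy_eq_sum [Fintype α] (μ : Ω → ℝ) (X : Ω → α) :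
    entropy μ X = ∑ ω, μ ω * -Real.log (fiberMass μ X ω) := by
  unfold entropy
  rw [← Finset.sum_fiberwise Finset.univ X]
  refine Finset.sum_congr rfl fun a _ => ?_
  rw [Real.negMulLog, neg_mul, ← mul_neg, Finset.sum_mul]
  refine Finset.sum_congr rfl fun ω hω => ?_
  obtain rfl : X ω = a := by simpa using hω
  rfl

/-- Entropy only depends on the partition of the sample space into fibres. -/
lemma entropy_congr [Fintype α] [Fintype β] (μ : Ω → ℝ) {X : Ω → α} {Y : Ω → β}
    (h : ∀ ω ω', X ω = X ω' ↔ Y ω = Y ω') : entropy μ X = entropy μ Y := by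
  simp only [entropy_eq_sum, fiberMass, h]

lemma entropy_comp [Fintype α] {Ω' : Type*} [Fintype Ω'] [DecidableEq Ω'] (μ : Ω → ℝ)
    (f : Ω → Ω') (X : Ω' → α) :
    entropy μ (fun ω => X (f ω)) =
      entropy (fun b => ∑ ω ∈ Finset.univ.filter (fun ω => f ω = b), μ ω) X := by
  unfold entropy
  refine Finset.sum_congr rfl fun a _ => congrArg _ ?_
  simp only [Finset.sum_filter]
  simp_rw [← Finset.sum_filter (fun b => X b = a)]
  rw [Finset.sum_comm]
  refine Finset.sum_congr rfl fun ω _ => ?_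
  simp [Finset.sum_ite_eq]

lemma sum_mul_fiberMass_ratio_le [Fintype α] [Fintype β] [Fintype γ] {μ : Ω → ℝ}
    (hμ : ∀ ω, 0 ≤ μ ω) (X : Ω → α) (Y : Ω → β) (Z : Ω → γ) :
    ∑ ω, μ ω * (fiberMass μ (fun ω => (X ω, Z ω)) ω * fiberMass μ (fun ω => (Y ω, Z ω)) ω /
      (fiberMass μ (fun ω => (X ω, Y ω, Z ω)) ω * fiberMass μ Z ω)) ≤ ∑ ω, μ ω := by
  let pxz : α → γ → ℝ := fun a c => ∑ ω ∈ Finset.univ.filter (fun ω => (X ω, Z ω) = (a, c)), μ ω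
  let pyz : β → γ → ℝ := fun b c => ∑ ω ∈ Finset.univ.filter (fun ω => (Y ω, Z ω) = (b, c)), μ ω
  let pz : γ → ℝ := fun c => ∑ ω ∈ Finset.univ.filter (fun ω => Z ω = c), μ ω
  have hpxz : ∀ a c, 0 ≤ pxz a c := fun a c => Finset.sum_nonneg fun ω _ => hμ ω
  have hpyz : ∀ b c, 0 ≤ pyz b c := fun b c => Finset.sum_nonneg fun ω _ => hμ ω
  have hpz : ∀ c, 0 ≤ pz c := fun c => Finset.sum_nonneg fun ω _ => hμ ω
  have sum_pxz : ∀ c, ∑ a, pxz a c = pz c := fun c => by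
    simp only [pxz, pz, Finset.sum_filter, Prod.mk.injEq]
    rw [Finset.sum_comm]
    refine Finset.sum_congr rfl fun ω _ => ?_
    by_cases h : Z ω = c <;> simp [h]
  have sum_pyz : ∀ c, ∑ b, pyz b c = pz c := fun c => by
    simp only [pyz, pz, Finset.sum_filter, Prod.mk.injEq]
    rw [Finset.sum_comm]
    refine Finset.sum_congr rfl fun ω _ => ?_
    by_cases h : Z ω = c <;> simp [h]
  calc _ ≤ ∑ t : α × β × γ, pxz t.1 t.2.2 * pyz t.2.1 t.2.2 / pz t.2.2 := by
        rw [← Finset.sum_fiberwise Finset.univ (fun ω => (X ω, Y ω, Z ω))]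
        refine Finset.sum_le_sum fun t _ => ?_
        obtain ⟨a, b, c⟩ := t
        set p := ∑ ω ∈ Finset.univ.filter (fun ω => (X ω, Y ω, Z ω) = (a, b, c)), μ ω with hp
        have hval : ∀ ω ∈ Finset.univ.filter (fun ω => (X ω, Y ω, Z ω) = (a, b, c)),
            μ ω * (fiberMass μ (fun ω => (X ω, Z ω)) ω * fiberMass μ (fun ω => (Y ω, Z ω)) ω /
              (fiberMass μ (fun ω => (X ω, Y ω, Z ω)) ω * fiberMass μ Z ω)) =
            μ ω * (pxz a c * pyz b c / (p * pz c)) := by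
          intro ω hω
          obtain ⟨rfl, rfl, rfl⟩ : X ω = a ∧ Y ω = b ∧ Z ω = c := by simpa using hω
          rfl
        rw [Finset.sum_congr rfl hval, ← Finset.sum_mul, ← hp]
        rcases eq_or_ne p 0 with h0 | h0
        · rw [h0, zero_mul]
          exact div_nonneg (mul_nonneg (hpxz _ _) (hpyz _ _)) (hpz _)
        · rw [← mul_div_assoc, mul_div_mul_left _ _ h0]
    _ = ∑ c, (∑ a, pxz a c) * (∑ b, pyz b c) / pz c := by
        simp_rw [Fintype.sum_prod_type]
        rw [Finset.sum_congr rfl fun a _ => Finset.sum_comm, Finset.sum_comm]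
        refine Finset.sum_congr rfl fun c _ => ?_
        rw [Finset.sum_mul_sum, Finset.sum_div]
        simp_rw [Finset.sum_div]
    _ = ∑ c, pz c := by simp [sum_pxz, sum_pyz]
    _ = ∑ ω, μ ω := Finset.sum_fiberwise Finset.univ Z μ

lemma condMI_nonneg [Fintype α] [Fintype β] [Fintype γ] {μ : Ω → ℝ} (hμ : ∀ ω, 0 ≤ μ ω)
    (X : Ω → α) (Y : Ω → β) (Z : Ω → γ) : 0 ≤ condMI μ X Y Z := by
  have key := sum_mul_fiberMass_ratio_le hμ X Y Z
  unfold condMI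
  simp only [entropy_eq_sum]
  rw [← Finset.sum_add_distrib, ← Finset.sum_sub_distrib, ← Finset.sum_sub_distrib]
  refine (sub_nonneg.2 key).trans ?_
  rw [← Finset.sum_sub_distrib]
  refine Finset.sum_le_sum fun ω _ => ?_
  rcases eq_or_ne (μ ω) 0 with h0 | h0
  · simp [h0]
  have h1 := fiberMass_pos hμ (fun ω => (X ω, Z ω)) h0
  have h2 := fiberMass_pos hμ (fun ω => (Y ω, Z ω)) h0
  have h3 := fiberMass_pos hμ (fun ω => (X ω, Y ω, Z ω)) h0
  have h4 := fiberMass_pos hμ Z h0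
  have hlog := Real.log_le_sub_one_of_pos (div_pos (mul_pos h1 h2) (mul_pos h3 h4))
  rw [Real.log_div (mul_pos h1 h2).ne' (mul_pos h3 h4).ne', Real.log_mul h1.ne' h2.ne',
    Real.log_mul h3.ne' h4.ne'] at hlog
  nlinarith [mul_le_mul_of_nonneg_left hlog (hμ ω)]

/-- If the value of `U` can be resampled according to a kernel `q` that is a function of `V`,
without changing `V`, then `q` is the conditional law of `U` given `V`. -/
lemma fiberMass_pair_of_resample [Fintype β] (μ : Ω → ℝ) (V : Ω → α) (U : Ω → β)
    (upd : Ω → β → Ω) (q : Ω → β → ℝ)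
    (hU : ∀ ω b, U (upd ω b) = b) (hupd : ∀ ω b, upd (upd ω b) (U ω) = ω)
    (hV : ∀ ω b, V (upd ω b) = V ω) (hqV : ∀ ω ω', V ω = V ω' → q ω = q ω')
    (hq : ∀ ω, ∑ b, q ω b = 1) (hμq : ∀ ω b, μ (upd ω b) * q ω (U ω) = μ ω * q ω b) (ω₀ : Ω) :
    fiberMass μ (fun ω => (V ω, U ω)) ω₀ = fiberMass μ V ω₀ * q ω₀ (U ω₀) := by
  let e : Ω × β ≃ Ω × β :=
    { toFun := fun t => (upd t.1 t.2, U t.1)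
      invFun := fun t => (upd t.1 t.2, U t.1)
      left_inv := fun t => by simp [hU, hupd]
      right_inv := fun t => by simp [hU, hupd] }
  have h : ∑ t : Ω × β, (if V t.1 = V ω₀ ∧ U t.1 = U ω₀ then μ t.1 * q t.1 t.2 else 0) =
      ∑ t : Ω × β, (if V t.1 = V ω₀ ∧ t.2 = U ω₀ then μ t.1 * q t.1 t.2 else 0) := by
    rw [← e.sum_comp]
    refine Finset.sum_congr rfl fun t _ => ?_
    simp only [e, Equiv.coe_fn_mk, hV, hU, hqV _ _ (hV t.1 t.2), hμq]
  rw [Fintype.sum_prod_type, Fintype.sum_prod_type] at h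
  simp only [fiberMass, Prod.mk.injEq, Finset.sum_filter, Finset.sum_mul]
  convert h using 1
  · refine Finset.sum_congr rfl fun ω _ => ?_
    split_ifs
    · rw [← mul_one (μ ω), ← hq ω, Finset.mul_sum]
    · simp
  · refine Finset.sum_congr rfl fun ω _ => ?_
    by_cases hω : V ω = V ω₀
    · simp [hω, hqV ω ω₀ hω]
    · simp [hω]

lemma entropy_pair_of_resample [Fintype α] [Fintype β] {μ : Ω → ℝ} (hμ : ∀ ω, 0 ≤ μ ω)
    (V : Ω → α) (U : Ω → β) (upd : Ω → β → Ω) (q : Ω → β → ℝ)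
    (hU : ∀ ω b, U (upd ω b) = b) (hupd : ∀ ω b, upd (upd ω b) (U ω) = ω)
    (hV : ∀ ω b, V (upd ω b) = V ω) (hqV : ∀ ω ω', V ω = V ω' → q ω = q ω')
    (hq : ∀ ω, ∑ b, q ω b = 1) (hμq : ∀ ω b, μ (upd ω b) * q ω (U ω) = μ ω * q ω b) :
    entropy μ (fun ω => (V ω, U ω)) = entropy μ V + ∑ ω, μ ω * -Real.log (q ω (U ω)) := by
  rw [entropy_eq_sum, entropy_eq_sum, ← Finset.sum_add_distrib]
  refine Finset.sum_congr rfl fun ω _ => ?_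
  rcases eq_or_ne (μ ω) 0 with h0 | h0
  · simp [h0]
  have hmass := fiberMass_pair_of_resample μ V U upd q hU hupd hV hqV hq hμq ω
  have hpos := fiberMass_pos hμ (fun ω => (V ω, U ω)) h0
  rw [hmass] at hpos ⊢
  rw [Real.log_mul (left_ne_zero_of_mul hpos.ne') (right_ne_zero_of_mul hpos.ne')]
  ring

end Entropy

/-- For a submodular `f`, the sets `D` minimizing `f` among the subsets of `D` have a largest
member. -/
lemma exists_largest_of_submodular {ι : Type*} [Fintype ι] [DecidableEq ι] (f : Finset ι → ℝ)
    (hf : ∀ A B, f (A ∪ B) + f (A ∩ B) ≤ f A + f B) :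
    ∃ D' : Finset ι, (∀ T ⊆ D', f D' ≤ f T) ∧
      ∀ D : Finset ι, (∀ T ⊆ D, f D ≤ f T) → D ⊆ D' := by
  classical
  let P : Finset ι → Prop := fun D => ∀ T ⊆ D, f D ≤ f T
  have h_union : ∀ A B, P A → P B → P (A ∪ B) := by
    intro A B hA hB T hT
    have h1 := hf T A
    have h2 := hf (T ∪ A) B
    have h3 := hA (T ∩ A) Finset.inter_subset_right
    have h4 := hB ((T ∪ A) ∩ B) Finset.inter_subset_right
    rw [Finset.union_assoc, Finset.union_eq_right.2 hT] at h2
    linarith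
  refine ⟨(Finset.univ.filter P).sup id, ?_, fun D hD => ?_⟩
  · change P _
    refine Finset.sup_induction ?_ (fun A hA B hB => h_union A B hA hB) (by simp)
    intro T hT
    rw [Finset.subset_empty.1 hT]
    rfl
  · exact Finset.le_sup (f := id) (Finset.mem_filter.2 ⟨Finset.mem_univ D, hD⟩)

lemma restrict_eq_iff {ι : Type*} {A : ι → Type*} (S : Finset ι) (x x' : ∀ i, A i) :
    ((fun i : S => x i) = fun i : S => x' i) ↔ ∀ i ∈ S, x i = x' i := by
  simp [funext_iff]

lemma eq_add_sum_of_insert {ι : Type*} [DecidableEq ι] (g : Finset ι → ℝ) (k : ι → ℝ)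
    (C S : Finset ι) (hCS : Disjoint C S)
    (h : ∀ T : Finset ι, C ⊆ T → ∀ i ∈ S, i ∉ T → g (insert i T) = g T + k i) :
    g (C ∪ S) = g C + ∑ i ∈ S, k i := by
  induction S using Finset.induction_on with
  | empty => simp
  | insert i S hi ih =>
    rw [Finset.disjoint_insert_right] at hCS
    rw [Finset.union_insert, h _ Finset.subset_union_left i (by simp) (by simp [hi, hCS.1]),
      ih hCS.2 fun T hT j hj => h T hT j (Finset.mem_insert_of_mem hj), Finset.sum_insert hi]
    ring

section Channel

variable {n : ℕ} {X0A YdA : Type} {XA YA YhA : Fin n → Type}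

lemma rvXS_eq_iff (S : Finset (Fin n)) (ω ω' : CFOmega X0A XA YA YdA YhA) :
    rvXS S ω = rvXS S ω' ↔ ∀ i ∈ S, ω.2.1 i = ω'.2.1 i :=
  restrict_eq_iff S _ _

lemma rvYS_eq_iff (S : Finset (Fin n)) (ω ω' : CFOmega X0A XA YA YdA YhA) :
    rvYS S ω = rvYS S ω' ↔ ∀ i ∈ S, ω.2.2.1 i = ω'.2.2.1 i :=
  restrict_eq_iff S _ _

lemma rvYhS_eq_iff (S : Finset (Fin n)) (ω ω' : CFOmega X0A XA YA YdA YhA) :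
    rvYhS S ω = rvYhS S ω' ↔ ∀ i ∈ S, ω.2.2.2.2 i = ω'.2.2.2.2 i :=
  restrict_eq_iff S _ _

lemma muCF_nonneg {p0 : X0A → ℝ} {pX : ∀ i, XA i → ℝ}
    {W : X0A → (∀ i, XA i) → ((∀ i, YA i) × YdA) → ℝ} {κ : ∀ i, YA i → XA i → YhA i → ℝ}
    (hp0 : ∀ x, 0 ≤ p0 x) (hpX : ∀ i x, 0 ≤ pX i x) (hW : ∀ x0 x y, 0 ≤ W x0 x y)
    (hκ : ∀ i y x yh, 0 ≤ κ i y x yh) (ω : CFOmega X0A XA YA YdA YhA) :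
    0 ≤ muCF p0 pX W κ ω :=
  mul_nonneg (mul_nonneg (mul_nonneg (hp0 _) (Finset.prod_nonneg fun i _ => hpX i _)) (hW _ _ _))
    (Finset.prod_nonneg fun i _ => hκ i _ _ _)

lemma prod_update_mul {A : Fin n → Type} (f : ∀ i, A i → ℝ) (x : ∀ i, A i) (i : Fin n) (b : A i) :
    (∏ j, f j (Function.update x i b j)) * f i (x i) = (∏ j, f j (x j)) * f i b := by
  rw [← Finset.mul_prod_erase _ _ (Finset.mem_univ i),
    ← Finset.mul_prod_erase (a := i) _ (fun j => f j (x j)) (Finset.mem_univ i),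
    Finset.prod_congr rfl fun j hj => by rw [Function.update_of_ne (Finset.ne_of_mem_erase hj)]]
  simp only [Function.update_self]
  ring

variable [Fintype X0A] [DecidableEq X0A] [Fintype YdA]
  [∀ i, Fintype (XA i)] [∀ i, DecidableEq (XA i)]
  [∀ i, Fintype (YA i)] [∀ i, Fintype (YhA i)]

lemma sum_muCF_inputs_eq {p0 : X0A → ℝ} {pX : ∀ i, XA i → ℝ}
    {W : X0A → (∀ i, XA i) → ((∀ i, YA i) × YdA) → ℝ} {κ : ∀ i, YA i → XA i → YhA i → ℝ}
    (hWs : ∀ x0 x, ∑ y, W x0 x y = 1) (hκs : ∀ i y x, ∑ yh, κ i y x yh = 1)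
    (b : X0A × ∀ i, XA i) :
    ∑ ω ∈ Finset.univ.filter
      (fun ω : CFOmega X0A XA YA YdA YhA => (ω.1, ω.2.1) = b), muCF p0 pX W κ ω =
      p0 b.1 * ∏ i, pX i (b.2 i) := by
  obtain ⟨x0, x⟩ := b
  have hκ1 : ∀ (y : ∀ i, YA i) (x : ∀ i, XA i),
      ∑ yh : ∀ i, YhA i, ∏ i, κ i (y i) (x i) (yh i) = 1 := by
    intro y x
    rw [← Fintype.piFinset_univ, ← Finset.prod_univ_sum]
    simp [hκs]
  have hW1 : ∀ x0 x, ∑ y, ∑ yd, W x0 x (y, yd) = 1 := fun x0 x => by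
    rw [← hWs x0 x, Fintype.sum_prod_type]
  rw [Finset.sum_filter, Fintype.sum_prod_type, Finset.sum_eq_single x0, Fintype.sum_prod_type,
    Finset.sum_eq_single x]
  · simp only [Fintype.sum_prod_type, muCF, if_true, ← Finset.mul_sum, hκ1, mul_one, hW1]
  · intro x' _ hx'
    simp [hx']
  · simp
  · intro x0' _ hx0'
    simp [hx0']
  · simp

set_option synthInstance.maxHeartbeats 400000
set_option synthInstance.maxSize 1000

/-- The relay inputs are independent of each other and of the source input. -/
lemma exists_entropy_inputs_insert {p0 : X0A → ℝ} {pX : ∀ i, XA i → ℝ}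
    {W : X0A → (∀ i, XA i) → ((∀ i, YA i) × YdA) → ℝ} {κ : ∀ i, YA i → XA i → YhA i → ℝ}
    (hp0 : ∀ x, 0 ≤ p0 x) (hpX : ∀ i x, 0 ≤ pX i x) (hpXs : ∀ i, ∑ x, pX i x = 1)
    (hWs : ∀ x0 x, ∑ y, W x0 x y = 1) (hκs : ∀ i y x, ∑ yh, κ i y x yh = 1) :
    ∃ a : Fin n → ℝ, ∀ (T : Finset (Fin n)) (i : Fin n), i ∉ T →
      entropy (muCF p0 pX W κ) (fun ω => (rvX0 ω, rvXS (insert i T) ω)) =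
        entropy (muCF p0 pX W κ) (fun ω => (rvX0 ω, rvXS T ω)) + a i := by
  let ν : (X0A × ∀ i, XA i) → ℝ := fun b => p0 b.1 * ∏ i, pX i (b.2 i)
  have hν : ∀ b, 0 ≤ ν b := fun b => mul_nonneg (hp0 _) (Finset.prod_nonneg fun i _ => hpX i _)
  have h_push : ∀ T : Finset (Fin n),
      entropy (muCF p0 pX W κ) (fun ω => (rvX0 ω, rvXS T ω)) =
        entropy ν (fun b => (b.1, fun i : T => b.2 i)) := fun T => by
    rw [show ν = _ from funext fun b => (sum_muCF_inputs_eq (W := W) (κ := κ) hWs hκs b).symm,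
      ← entropy_comp]
    rfl
  refine ⟨fun i => ∑ b, ν b * -Real.log (pX i (b.2 i)), fun T i hi => ?_⟩
  have hne : ∀ j ∈ T, j ≠ i := fun j hj hji => hi (hji ▸ hj)
  rw [h_push, h_push, ← entropy_pair_of_resample hν (fun b => (b.1, fun i : T => b.2 i))
    (fun b => b.2 i) (fun b u => (b.1, Function.update b.2 i u)) (fun _ => pX i)]
  · refine entropy_congr ν fun b b' => ?_
    simp only [Prod.mk.injEq, restrict_eq_iff, Finset.forall_mem_insert]
    tauto
  · simp
  · simp
  · intro b u
    simp only [Prod.mk.injEq, restrict_eq_iff, true_and]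
    exact fun j hj => Function.update_of_ne (hne j hj) _ _
  · simp
  · exact fun _ => hpXs i
  · intro b u
    simp only [ν, mul_assoc, prod_update_mul]

variable [DecidableEq YdA] [∀ i, DecidableEq (YhA i)]

/-- The joint entropy `H(X_T, Ŷ_T, X_0, Y_{n+1})`. -/
noncomputable def jointEntropy (μ : CFOmega X0A XA YA YdA YhA → ℝ) (T : Finset (Fin n)) : ℝ :=
  entropy μ (fun ω => (rvX0 ω, rvXS T ω, rvYd ω, rvYhS T ω))

lemma jointEntropy_submodular {μ : CFOmega X0A XA YA YdA YhA → ℝ} (hμ : ∀ ω, 0 ≤ μ ω)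
    (A B : Finset (Fin n)) :
    jointEntropy μ (A ∪ B) + jointEntropy μ (A ∩ B) ≤ jointEntropy μ A + jointEntropy μ B := by
  have h := condMI_nonneg hμ (fun ω => (rvXS A ω, rvYhS A ω)) (fun ω => (rvXS B ω, rvYhS B ω))
    (fun ω => (rvX0 ω, rvXS (A ∩ B) ω, rvYd ω, rvYhS (A ∩ B) ω))
  unfold condMI at h
  have hA : entropy μ (fun ω => ((rvXS A ω, rvYhS A ω),
      (rvX0 ω, rvXS (A ∩ B) ω, rvYd ω, rvYhS (A ∩ B) ω))) = jointEntropy μ A :=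
    entropy_congr μ fun ω ω' => by
      simp only [Prod.mk.injEq, rvXS_eq_iff, rvYhS_eq_iff, Finset.mem_inter]
      grind
  have hB : entropy μ (fun ω => ((rvXS B ω, rvYhS B ω),
      (rvX0 ω, rvXS (A ∩ B) ω, rvYd ω, rvYhS (A ∩ B) ω))) = jointEntropy μ B :=
    entropy_congr μ fun ω ω' => by
      simp only [Prod.mk.injEq, rvXS_eq_iff, rvYhS_eq_iff, Finset.mem_inter]
      grind
  have hAB : entropy μ (fun ω => ((rvXS A ω, rvYhS A ω), (rvXS B ω, rvYhS B ω),
      (rvX0 ω, rvXS (A ∩ B) ω, rvYd ω, rvYhS (A ∩ B) ω))) = jointEntropy μ (A ∪ B) :=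
    entropy_congr μ fun ω ω' => by
      simp only [Prod.mk.injEq, rvXS_eq_iff, rvYhS_eq_iff, Finset.mem_inter, Finset.mem_union]
      grind
  rw [hA, hB, hAB] at h
  unfold jointEntropy at h ⊢
  linarith

variable [∀ i, DecidableEq (YA i)]

/-- Given `(Yᵢ, Xᵢ)`, the compression `Ŷᵢ` is independent of everything else. -/
lemma exists_entropy_compressions_insert {p0 : X0A → ℝ} {pX : ∀ i, XA i → ℝ}
    {W : X0A → (∀ i, XA i) → ((∀ i, YA i) × YdA) → ℝ} {κ : ∀ i, YA i → XA i → YhA i → ℝ}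
    (hμ : ∀ ω, 0 ≤ muCF p0 pX W κ ω) (hκs : ∀ i y x, ∑ yh, κ i y x yh = 1) :
    ∃ k : Fin n → ℝ, ∀ (A B C : Finset (Fin n)) (i : Fin n), i ∈ A → i ∈ B → i ∉ C →
      entropy (muCF p0 pX W κ)
          (fun ω => (rvYS A ω, rvX0 ω, rvXS B ω, rvYd ω, rvYhS (insert i C) ω)) =
        entropy (muCF p0 pX W κ)
          (fun ω => (rvYS A ω, rvX0 ω, rvXS B ω, rvYd ω, rvYhS C ω)) + k i := by
  refine ⟨fun i => ∑ ω, muCF p0 pX W κ ω *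
    -Real.log (κ i (ω.2.2.1 i) (ω.2.1 i) (ω.2.2.2.2 i)), fun A B C i hA hB hC => ?_⟩
  have hne : ∀ j ∈ C, j ≠ i := fun j hj hji => hC (hji ▸ hj)
  rw [← entropy_pair_of_resample hμ
    (fun ω => (rvYS A ω, rvX0 ω, rvXS B ω, rvYd ω, rvYhS C ω))
    (fun ω => ω.2.2.2.2 i)
    (fun ω u => (ω.1, ω.2.1, ω.2.2.1, ω.2.2.2.1, Function.update ω.2.2.2.2 i u))
    (fun ω => κ i (ω.2.2.1 i) (ω.2.1 i))]
  · refine entropy_congr _ fun ω ω' => ?_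
    simp only [Prod.mk.injEq, rvYhS_eq_iff, Finset.forall_mem_insert]
    tauto
  · simp
  · simp
  · intro ω u
    simp only [Prod.mk.injEq, rvYhS_eq_iff]
    exact ⟨rfl, rfl, rfl, rfl, fun j hj => Function.update_of_ne (hne j hj) _ _⟩
  · intro ω ω' h
    simp only [Prod.mk.injEq, rvYS_eq_iff, rvXS_eq_iff] at h
    rw [h.1 i hA, h.2.2.1 i hB]
  · exact fun _ => hκs i _ _
  · intro ω u
    simp only [muCF, mul_assoc,
      prod_update_mul (fun j => κ j (ω.2.2.1 j) (ω.2.1 j)) ω.2.2.2.2 i u]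

/-- Up to a modular function, the decodability gap is a difference of joint entropies. -/
lemma exists_cfGap_eq {p0 : X0A → ℝ} {pX : ∀ i, XA i → ℝ}
    {W : X0A → (∀ i, XA i) → ((∀ i, YA i) × YdA) → ℝ} {κ : ∀ i, YA i → XA i → YhA i → ℝ}
    (hp0 : ∀ x, 0 ≤ p0 x) (hpX : ∀ i x, 0 ≤ pX i x) (hpXs : ∀ i, ∑ x, pX i x = 1)
    (hW : ∀ x0 x y, 0 ≤ W x0 x y) (hWs : ∀ x0 x, ∑ y, W x0 x y = 1)
    (hκ : ∀ i y x yh, 0 ≤ κ i y x yh) (hκs : ∀ i y x, ∑ yh, κ i y x yh = 1) :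
    ∃ c : Fin n → ℝ, ∀ D S : Finset (Fin n), S ⊆ D →
      cfGap (muCF p0 pX W κ) D S =
        jointEntropy (muCF p0 pX W κ) (D \ S) - jointEntropy (muCF p0 pX W κ) D +
          ∑ i ∈ S, c i := by
  have hμ := muCF_nonneg (YhA := YhA) hp0 hpX hW hκ
  obtain ⟨a, ha⟩ := exists_entropy_inputs_insert hp0 hpX hpXs hWs hκs
  obtain ⟨k, hk⟩ := exists_entropy_compressions_insert hμ hκs
  set μ := muCF p0 pX W κ
  refine ⟨fun i => a i + k i, fun D S hS => ?_⟩
  have hDS : D \ S ∪ S = D := Finset.sdiff_union_of_subset hS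
  have h_mem : ∀ i, i ∈ D ↔ i ∈ S ∨ i ∈ D \ S := fun i => by grind
  have h_inputs := eq_add_sum_of_insert
    (fun T => entropy μ (fun ω => (rvX0 ω, rvXS T ω))) a (D \ S) S Finset.sdiff_disjoint
    fun T _ i _ hi => ha T i hi
  have h_compr := eq_add_sum_of_insert
    (fun C => entropy μ (fun ω => (rvYS S ω, rvX0 ω, rvXS D ω, rvYd ω, rvYhS C ω))) k
    (D \ S) S Finset.sdiff_disjoint fun T _ i hi hiT => hk S D T i hi (hS hi) hiT
  rw [hDS] at h_inputs h_compr
  have e1 : entropy μ (fun ω => (rvXS S ω, rvX0 ω, rvXS (D \ S) ω)) =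
      entropy μ (fun ω => (rvX0 ω, rvXS D ω)) :=
    entropy_congr μ fun ω ω' => by
      simp only [Prod.mk.injEq, rvXS_eq_iff, h_mem]
      grind
  have e2 : entropy μ (fun ω => ((rvYhS (D \ S) ω, rvYd ω), rvX0 ω, rvXS (D \ S) ω)) =
      jointEntropy μ (D \ S) :=
    entropy_congr μ fun ω ω' => by
      simp only [Prod.mk.injEq]
      tauto
  have e3 : entropy μ (fun ω =>
        (rvXS S ω, (rvYhS (D \ S) ω, rvYd ω), rvX0 ω, rvXS (D \ S) ω)) =
      entropy μ (fun ω => (rvX0 ω, rvXS D ω, rvYd ω, rvYhS (D \ S) ω)) :=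
    entropy_congr μ fun ω ω' => by
      simp only [Prod.mk.injEq, rvXS_eq_iff, rvYhS_eq_iff, h_mem]
      grind
  have e4 : entropy μ (fun ω => (rvYhS S ω, rvX0 ω, rvXS D ω, rvYd ω, rvYhS (D \ S) ω)) =
      jointEntropy μ D :=
    entropy_congr μ fun ω ω' => by
      simp only [Prod.mk.injEq, rvXS_eq_iff, rvYhS_eq_iff, h_mem]
      grind
  have e5 : entropy μ (fun ω =>
        (rvYS S ω, rvYhS S ω, rvX0 ω, rvXS D ω, rvYd ω, rvYhS (D \ S) ω)) =
      entropy μ (fun ω => (rvYS S ω, rvX0 ω, rvXS D ω, rvYd ω, rvYhS D ω)) :=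
    entropy_congr μ fun ω ω' => by
      simp only [Prod.mk.injEq, rvXS_eq_iff, rvYhS_eq_iff, h_mem]
      grind
  unfold cfGap condMI
  rw [e1, e2, e3, e4, e5, Finset.sum_add_distrib]
  linarith

end Channel

/-- Among all subsets of `N` that are weakly decodable there is a
unique largest one: there exists a weakly decodable subset `D' ⊆ N` containing every
weakly decodable subset of `N`. -/
theorem exists_largest_weaklyDecodable
    {n : ℕ} {X0A YdA : Type} {XA YA YhA : Fin n → Type}
    [Fintype X0A] [DecidableEq X0A] [Fintype YdA] [DecidableEq YdA]
    [∀ i, Fintype (XA i)] [∀ i, DecidableEq (XA i)]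
    [∀ i, Fintype (YA i)] [∀ i, DecidableEq (YA i)]
    [∀ i, Fintype (YhA i)] [∀ i, DecidableEq (YhA i)]
    (p0 : X0A → ℝ) (pX : ∀ i, XA i → ℝ)
    (W : X0A → (∀ i, XA i) → ((∀ i, YA i) × YdA) → ℝ)
    (κ : ∀ i, YA i → XA i → YhA i → ℝ)
    (hp0 : ∀ x, 0 ≤ p0 x) (hp0s : ∑ x, p0 x = 1)
    (hpX : ∀ i x, 0 ≤ pX i x) (hpXs : ∀ i, ∑ x, pX i x = 1)
    (hW : ∀ x0 x y, 0 ≤ W x0 x y) (hWs : ∀ x0 x, ∑ y, W x0 x y = 1)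
    (hκ : ∀ i y x yh, 0 ≤ κ i y x yh) (hκs : ∀ i y x, ∑ yh, κ i y x yh = 1) :
    ∃ D' : Finset (Fin n), WeaklyDecodable (muCF p0 pX W κ) D' ∧
      ∀ D : Finset (Fin n), WeaklyDecodable (muCF p0 pX W κ) D → D ⊆ D' := by
  obtain ⟨c, hc⟩ := exists_cfGap_eq hp0 hpX hpXs hW hWs hκ hκs
  have hμ := muCF_nonneg (YhA := YhA) hp0 hpX hW hκ
  set μ := muCF p0 pX W κ
  have h_iff : ∀ D, WeaklyDecodable μ D ↔
      ∀ T ⊆ D, jointEntropy μ D - ∑ i ∈ D, c i ≤ jointEntropy μ T - ∑ i ∈ T, c i := by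
    intro D
    have h_gap : ∀ S ⊆ D, cfGap μ D S = (jointEntropy μ (D \ S) - ∑ i ∈ D \ S, c i) -
        (jointEntropy μ D - ∑ i ∈ D, c i) := fun S hS => by
      rw [hc D S hS, ← Finset.sum_sdiff hS]
      ring
    constructor
    · intro h T hT
      have := h (D \ T) Finset.sdiff_subset
      rw [h_gap _ Finset.sdiff_subset, Finset.sdiff_sdiff_eq_self hT] at this
      linarith
    · intro h S hS
      rw [h_gap S hS]
      linarith [h (D \ S) Finset.sdiff_subset]
  simp only [h_iff]
  refine exists_largest_of_submodular _ fun A B => ?_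
  linarith [jointEntropy_submodular hμ A B, Finset.sum_union_inter (s₁ := A) (s₂ := B) (f := c)]
end

section
/- For the multiple-relay channel with all relays performing compress-and-forward, the noisy-network-coding/joint-decoding rate equals the successive-decoding rate: the supremum over all admissible distributions of min over S ⊆ N of [ I(X_0, X_S; Ŷ_{N∖S}, Y_{n+1} | X_{N∖S}) − I(Y_S; Ŷ_S | X_0, X_N, Y_{n+1}, Ŷ_{N∖S}) ] equals the supremum of I(X_0; Ŷ_N, Y_{n+1} | X_N) over all admissible distributions additionally satisfying, for every S ⊆ N, I(X_S; Ŷ_{N∖S}, Y_{n+1} | X_{N∖S}) − I(Y_S; Ŷ_S | X_N, Y_{n+1}, Ŷ_{N∖S}) ≥ 0. -/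
open scoped BigOperators

section CF2

variable {n : ℕ} {X0A YdA : Type} {XA YA YhA : Fin n → Type}
  [Fintype X0A] [DecidableEq X0A] [Fintype YdA] [DecidableEq YdA]
  [∀ i, Fintype (XA i)] [∀ i, DecidableEq (XA i)]
  [∀ i, Fintype (YA i)] [∀ i, DecidableEq (YA i)]
  [∀ i, Fintype (YhA i)] [∀ i, DecidableEq (YhA i)]

/-- The successive-decoding constraint gap
`I(X_S; Ŷ_{N∖S}, Y_{n+1} | X_{N∖S}) − I(Y_S; Ŷ_S | X_N, Y_{n+1}, Ŷ_{N∖S})`. -/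
noncomputable def scGap (μ : CFOmega X0A XA YA YdA YhA → ℝ) (S : Finset (Fin n)) : ℝ :=
  condMI μ (rvXS S) (fun ω => (rvYhS (Finset.univ \ S) ω, rvYd ω))
    (rvXS (Finset.univ \ S))
  - condMI μ (rvYS S) (rvYhS S)
    (fun ω => (rvXS (Finset.univ : Finset (Fin n)) ω, rvYd ω, rvYhS (Finset.univ \ S) ω))

end CF2

namespace CFRate

section Entropy

variable {Ω α β γ : Type*} [Fintype Ω] [Fintype α] [DecidableEq α] [Fintype β] [DecidableEq β]
  [Fintype γ] [DecidableEq γ]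

theorem entropy_eq_sum (μ : Ω → ℝ) (X : Ω → α) :
    entropy μ X
      = ∑ ω, -(μ ω * Real.log (∑ ω' ∈ Finset.univ.filter (fun ω' => X ω' = X ω), μ ω')) := by
  unfold entropy
  rw [← Finset.sum_fiberwise Finset.univ X]
  refine Finset.sum_congr rfl fun a _ => ?_
  rw [Real.negMulLog, neg_mul, Finset.sum_mul, ← Finset.sum_neg_distrib]
  refine Finset.sum_congr rfl fun ω hω => ?_
  rw [(Finset.mem_filter.1 hω).2]

/-- Entropy only depends on the partition induced by the random variable. -/
theorem entropy_congr (μ : Ω → ℝ) {X : Ω → α} {Y : Ω → β}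
    (h : ∀ ω ω', X ω = X ω' ↔ Y ω = Y ω') : entropy μ X = entropy μ Y := by
  rw [entropy_eq_sum, entropy_eq_sum]
  simp only [h]

theorem entropy_comp_equiv {Ω' : Type*} [Fintype Ω'] (e : Ω ≃ Ω') (μ : Ω → ℝ) (X : Ω → α) :
    entropy μ X = entropy (fun p => μ (e.symm p)) (fun p => X (e.symm p)) := by
  unfold entropy
  refine Finset.sum_congr rfl fun a _ => ?_
  congr 1
  rw [Finset.sum_filter, Finset.sum_filter]
  exact Fintype.sum_equiv e _ _ (fun ω => by simp)

theorem mul_log_sub_log_le {a p : ℝ} (ha : 0 ≤ a) (hp : 0 ≤ p) (h : p = 0 → a = 0) :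
    a * (Real.log p - Real.log a) ≤ p - a := by
  rcases ha.eq_or_lt with rfl | ha
  · simpa using hp
  have hp : 0 < p := lt_of_le_of_ne hp fun h0 => ha.ne' (h h0.symm)
  rw [← Real.log_div hp.ne' ha.ne']
  calc a * Real.log (p / a) ≤ a * (p / a - 1) :=
        mul_le_mul_of_nonneg_left (Real.log_le_sub_one_of_pos (div_pos hp ha)) ha.le
    _ = p - a := by field_simp

/-- The two-term log-sum inequality. -/
theorem log_sum_two {a b A B : ℝ} (ha : 0 ≤ a) (hb : 0 ≤ b) (hA : 0 ≤ A) (hB : 0 ≤ B)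
    (hA0 : A = 0 → a = 0) (hB0 : B = 0 → b = 0) :
    (a + b) * (Real.log (a + b) - Real.log (A + B))
      ≤ a * (Real.log a - Real.log A) + b * (Real.log b - Real.log B) := by
  rcases ha.eq_or_lt with rfl | ha
  · rcases hb.eq_or_lt with rfl | hb
    · simp
    have hB : 0 < B := lt_of_le_of_ne hB fun h => hb.ne' (hB0 h.symm)
    have := Real.log_le_log hB (by linarith : B ≤ A + B)
    simp only [zero_add, zero_mul]
    exact mul_le_mul_of_nonneg_left (by linarith) hb.le
  have hA : 0 < A := lt_of_le_of_ne hA fun h => ha.ne' (hA0 h.symm)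
  rcases hb.eq_or_lt with rfl | hb
  · have := Real.log_le_log hA (by linarith : A ≤ A + B)
    simp only [add_zero, zero_mul]
    exact mul_le_mul_of_nonneg_left (by linarith) ha.le
  have hB : 0 < B := lt_of_le_of_ne hB fun h => hb.ne' (hB0 h.symm)
  have key : ∀ {x X : ℝ}, 0 < x → 0 < X →
      x * (Real.log X + Real.log (a + b) - Real.log (A + B) - Real.log x)
        ≤ X * (a + b) / (A + B) - x := by
    intro x X hx hX
    have h := mul_log_sub_log_le (a := x) (p := X * (a + b) / (A + B)) hx.le (by positivity)
      (fun h => absurd h (by positivity))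
    rwa [Real.log_div (by positivity) (by positivity),
      Real.log_mul (by positivity) (by positivity)] at h
  have h1 := key ha hA
  have h2 := key hb hB
  have h3 : A * (a + b) / (A + B) + B * (a + b) / (A + B) = a + b := by field_simp
  nlinarith

/-- The Jensen defect of `negMulLog` with respect to the weights `m` on `s`. -/
noncomputable def jensenDefect {ι : Type*} (s : Finset ι) (m a : ι → ℝ) : ℝ :=
  Real.negMulLog (∑ i ∈ s, m i * a i) - ∑ i ∈ s, m i * Real.negMulLog (a i)

section JensenDefect

variable {ι : Type*} (s : Finset ι) (m : ι → ℝ)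

theorem jensenDefect_smul (c : ℝ) (a : ι → ℝ) :
    jensenDefect s m (fun i => c * a i) = c * jensenDefect s m a := by
  unfold jensenDefect
  have h : ∑ i ∈ s, m i * (c * a i) = c * ∑ i ∈ s, m i * a i := by
    rw [Finset.mul_sum]; exact Finset.sum_congr rfl fun i _ => by ring
  rw [h, Real.negMulLog_mul]
  simp only [Real.negMulLog_mul, mul_add, Finset.sum_add_distrib]
  have h1 : ∑ i ∈ s, m i * (a i * Real.negMulLog c)
      = (∑ i ∈ s, m i * a i) * Real.negMulLog c := by
    rw [Finset.sum_mul]; exact Finset.sum_congr rfl fun i _ => by ring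
  have h2 : ∑ i ∈ s, m i * (c * Real.negMulLog (a i))
      = c * ∑ i ∈ s, m i * Real.negMulLog (a i) := by
    rw [Finset.mul_sum]; exact Finset.sum_congr rfl fun i _ => by ring
  rw [h1, h2]
  ring

variable {m}

theorem jensenDefect_add_le (hm : ∀ i, 0 ≤ m i) {a b : ι → ℝ} (ha : ∀ i, 0 ≤ a i)
    (hb : ∀ i, 0 ≤ b i) :
    jensenDefect s m (fun i => a i + b i) ≤ jensenDefect s m a + jensenDefect s m b := by
  have expand : ∀ f : ι → ℝ, jensenDefect s m f
      = ∑ i ∈ s, m i * (f i * (Real.log (f i) - Real.log (∑ j ∈ s, m j * f j))) := by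
    intro f
    unfold jensenDefect
    simp only [Real.negMulLog, neg_mul, mul_neg, Finset.sum_neg_distrib, mul_sub,
      Finset.sum_sub_distrib]
    rw [Finset.sum_mul]
    simp only [mul_assoc]
    ring
  rw [expand, expand, expand, ← Finset.sum_add_distrib]
  refine Finset.sum_le_sum fun i hi => ?_
  rcases (hm i).eq_or_lt with h0 | h0
  · simp [← h0]
  rw [← mul_add]
  refine mul_le_mul_of_nonneg_left ?_ h0.le
  have vanish : ∀ f : ι → ℝ, (∀ j, 0 ≤ f j) → ∑ j ∈ s, m j * f j = 0 → f i = 0 := by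
    intro f hf h
    have := (Finset.sum_eq_zero_iff_of_nonneg fun j _ => mul_nonneg (hm j) (hf j)).1 h i hi
    exact (mul_eq_zero.1 this).resolve_left h0.ne'
  simp only [mul_add, Finset.sum_add_distrib]
  exact log_sum_two (ha i) (hb i)
    (Finset.sum_nonneg fun j _ => mul_nonneg (hm j) (ha j))
    (Finset.sum_nonneg fun j _ => mul_nonneg (hm j) (hb j)) (vanish a ha) (vanish b hb)

theorem jensenDefect_sum_le (hm : ∀ i, 0 ≤ m i) {κ : Type*} (t : Finset κ) (f : κ → ι → ℝ)
    (hf : ∀ k i, 0 ≤ f k i) :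
    jensenDefect s m (fun i => ∑ k ∈ t, f k i) ≤ ∑ k ∈ t, jensenDefect s m (f k) := by
  classical
  induction t using Finset.induction_on with
  | empty => simp [jensenDefect]
  | insert k t hk ih =>
    simp only [Finset.sum_insert hk]
    have h := jensenDefect_add_le s hm (hf k)
      (fun i => Finset.sum_nonneg fun k (_ : k ∈ t) => hf k i)
    linarith

end JensenDefect

/-- Strong subadditivity of entropy. -/
theorem condMI_nonneg {μ : Ω → ℝ} (hμ : ∀ ω, 0 ≤ μ ω) (X : Ω → α) (Y : Ω → β) (Z : Ω → γ) :
    0 ≤ condMI μ X Y Z := by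
  have hP : ∀ P : α → β → γ → ℝ, (∀ a b c, 0 ≤ P a b c) →
      0 ≤ ∑ c, (∑ a, Real.negMulLog (∑ b, P a b c) + ∑ b, Real.negMulLog (∑ a, P a b c)
        - ∑ a, ∑ b, Real.negMulLog (P a b c) - Real.negMulLog (∑ a, ∑ b, P a b c)) := by
    intro P hP
    refine Finset.sum_nonneg fun c _ => ?_
    have h := jensenDefect_sum_le (m := fun _ : α => (1 : ℝ)) Finset.univ (fun _ => zero_le_one)
      (Finset.univ : Finset β) (fun b a => P a b c) (fun b a => hP a b c)
    simp only [jensenDefect, one_mul, Finset.sum_sub_distrib] at h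
    rw [Finset.sum_comm (f := fun b a => Real.negMulLog (P a b c))] at h
    linarith
  have h := hP (fun a b c => ∑ ω ∈ Finset.univ.filter (fun ω => (X ω, Y ω, Z ω) = (a, b, c)), μ ω)
    (fun a b c => Finset.sum_nonneg fun ω _ => hμ ω)
  have e1 : ∀ a c, ∑ b, ∑ ω ∈ Finset.univ.filter (fun ω => (X ω, Y ω, Z ω) = (a, b, c)), μ ω
      = ∑ ω ∈ Finset.univ.filter (fun ω => (X ω, Z ω) = (a, c)), μ ω := by
    intro a c
    rw [← Finset.sum_fiberwise _ Y]
    refine Finset.sum_congr rfl fun b _ => Finset.sum_congr ?_ fun _ _ => rfl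
    ext ω; simp; tauto
  have e2 : ∀ b c, ∑ a, ∑ ω ∈ Finset.univ.filter (fun ω => (X ω, Y ω, Z ω) = (a, b, c)), μ ω
      = ∑ ω ∈ Finset.univ.filter (fun ω => (Y ω, Z ω) = (b, c)), μ ω := by
    intro b c
    rw [← Finset.sum_fiberwise _ X]
    refine Finset.sum_congr rfl fun a _ => Finset.sum_congr ?_ fun _ _ => rfl
    ext ω; simp; tauto
  have e3 : ∀ c, ∑ a, ∑ ω ∈ Finset.univ.filter (fun ω => (X ω, Z ω) = (a, c)), μ ω
      = ∑ ω ∈ Finset.univ.filter (fun ω => Z ω = c), μ ω := by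
    intro c
    rw [← Finset.sum_fiberwise _ X]
    refine Finset.sum_congr rfl fun a _ => Finset.sum_congr ?_ fun _ _ => rfl
    ext ω; simp; tauto
  simp only [e1, e2, e3, Finset.sum_add_distrib, Finset.sum_sub_distrib] at h
  unfold condMI entropy
  rw [Fintype.sum_prod_type_right, Fintype.sum_prod_type_right, Fintype.sum_prod_type,
    Fintype.sum_congr _ _ (fun a => Fintype.sum_prod_type_right _)]
  rw [Finset.sum_comm (s := (Finset.univ : Finset α))]
  rwa [Finset.sum_congr rfl (fun c _ => Finset.sum_comm
    (f := fun a b => Real.negMulLog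
      (∑ ω ∈ Finset.univ.filter (fun ω => (X ω, Y ω, Z ω) = (a, b, c)), μ ω)))] at h ⊢

end Entropy

section Kernel

variable {R B α : Type*} [Fintype R] [Fintype B] [DecidableEq B] [Fintype α] [DecidableEq α]
  (m : R → ℝ) (k : R → B → ℝ) (v : R → α)

omit [DecidableEq B] in
theorem entropy_marginal (hk : ∀ r, ∑ b, k r b = 1) :
    entropy (fun p : R × B => m p.1 * k p.1 p.2) (fun p => v p.1) = entropy m v := by
  unfold entropy
  refine Finset.sum_congr rfl fun a _ => ?_
  congr 1
  rw [Finset.sum_filter, Finset.sum_filter, Fintype.sum_prod_type]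
  refine Finset.sum_congr rfl fun r _ => ?_
  by_cases h : v r = a
  · simp [h, ← Finset.mul_sum, hk]
  · simp [h]

theorem entropy_kernel_pair :
    entropy (fun p : R × B => m p.1 * k p.1 p.2) (fun p => (p.2, v p.1))
      = ∑ a, ∑ b, Real.negMulLog (∑ r ∈ Finset.univ.filter (fun r => v r = a), m r * k r b) := by
  unfold entropy
  rw [Fintype.sum_prod_type_right]
  refine Finset.sum_congr rfl fun a _ => Finset.sum_congr rfl fun b _ => ?_
  congr 1
  rw [Finset.sum_filter, Finset.sum_filter, Fintype.sum_prod_type]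
  refine Finset.sum_congr rfl fun r _ => ?_
  by_cases h : v r = a
  · simp [h]
  · simp [h]

/-- Chain rule when the kernel only depends on the conditioning variable. -/
theorem entropy_kernel_chain (hk : ∀ r, ∑ b, k r b = 1) (hv : ∀ r r', v r = v r' → k r = k r') :
    entropy (fun p : R × B => m p.1 * k p.1 p.2) (fun p => (p.2, v p.1))
      = entropy m v + ∑ r, m r * ∑ b, Real.negMulLog (k r b) := by
  rw [entropy_kernel_pair, ← Finset.sum_fiberwise Finset.univ v, entropy,
    ← Finset.sum_add_distrib]
  refine Finset.sum_congr rfl fun a _ => ?_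
  by_cases hne : ∃ r, v r = a
  · obtain ⟨r₀, rfl⟩ := hne
    have h1 : ∀ b, ∑ r ∈ Finset.univ.filter (fun r => v r = v r₀), m r * k r b
        = (∑ r ∈ Finset.univ.filter (fun r => v r = v r₀), m r) * k r₀ b := by
      intro b
      rw [Finset.sum_mul]
      refine Finset.sum_congr rfl fun r hr => ?_
      rw [hv r r₀ (Finset.mem_filter.1 hr).2]
    have h2 : ∑ r ∈ Finset.univ.filter (fun r => v r = v r₀), m r * ∑ b, Real.negMulLog (k r b)
        = (∑ r ∈ Finset.univ.filter (fun r => v r = v r₀), m r)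
          * ∑ b, Real.negMulLog (k r₀ b) := by
      rw [Finset.sum_mul]
      refine Finset.sum_congr rfl fun r hr => ?_
      rw [hv r r₀ (Finset.mem_filter.1 hr).2]
    simp only [h1, h2, Real.negMulLog_mul, Finset.sum_add_distrib, ← Finset.sum_mul,
      ← Finset.mul_sum, hk, one_mul]
  · have : Finset.univ.filter (fun r => v r = a) = ∅ :=
      Finset.filter_eq_empty_iff.2 fun r _ h => hne ⟨r, h⟩
    simp [this]

theorem entropy_kernel_sub :
    entropy (fun p : R × B => m p.1 * k p.1 p.2) (fun p => (p.2, v p.1))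
        - ∑ r, m r * ∑ b, Real.negMulLog (k r b)
      = ∑ a, ∑ b, jensenDefect (Finset.univ.filter (fun r => v r = a)) m (fun r => k r b) := by
  rw [entropy_kernel_pair, ← Finset.sum_fiberwise Finset.univ v, ← Finset.sum_sub_distrib]
  refine Finset.sum_congr rfl fun a _ => ?_
  simp only [jensenDefect, Finset.sum_sub_distrib, Finset.mul_sum]
  rw [Finset.sum_comm (s := (Finset.univ : Finset B))]

/-- Mixing a kernel with a point mass does not increase the information it carries. -/
theorem entropy_kernel_mix_le (hm : ∀ r, 0 ≤ m r) (hk0 : ∀ r b, 0 ≤ k r b)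
    (hk : ∀ r, ∑ b, k r b = 1) (c : B) {t : ℝ} (ht0 : 0 ≤ t) (ht1 : t ≤ 1) :
    entropy (fun p : R × B => m p.1 * ((1 - t) * k p.1 p.2 + t * if p.2 = c then 1 else 0))
          (fun p => (p.2, v p.1))
        - ∑ r, m r * ∑ b, Real.negMulLog ((1 - t) * k r b + t * if b = c then 1 else 0)
      ≤ entropy (fun p : R × B => m p.1 * k p.1 p.2) (fun p => (p.2, v p.1))
        - ∑ r, m r * ∑ b, Real.negMulLog (k r b) := by
  rw [entropy_kernel_sub m (fun r b => (1 - t) * k r b + t * if b = c then 1 else 0) v,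
    entropy_kernel_sub]
  refine Finset.sum_le_sum fun a _ => ?_
  set s := Finset.univ.filter (fun r => v r = a)
  have hunit : jensenDefect s m (fun _ => 1) ≤ ∑ b, jensenDefect s m (fun r => k r b) := by
    have h := jensenDefect_sum_le s hm Finset.univ (fun b r => k r b) (fun b r => hk0 r b)
    simpa only [hk] using h
  have hpoint : ∑ b, jensenDefect s m (fun _ => if b = c then (1 : ℝ) else 0)
      = jensenDefect s m (fun _ => 1) := by
    rw [Finset.sum_eq_single c]
    · simp
    · intro b _ hb
      simp [hb, jensenDefect]
    · simp
  calc ∑ b, jensenDefect s m (fun r => (1 - t) * k r b + t * if b = c then 1 else 0)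
      ≤ ∑ b, ((1 - t) * jensenDefect s m (fun r => k r b)
          + t * jensenDefect s m (fun _ => if b = c then (1 : ℝ) else 0)) := by
        refine Finset.sum_le_sum fun b _ => ?_
        rw [← jensenDefect_smul, ← jensenDefect_smul]
        refine jensenDefect_add_le s hm (fun r => mul_nonneg (by linarith) (hk0 r b)) fun r => ?_
        split_ifs <;> simp [ht0]
    _ = (1 - t) * ∑ b, jensenDefect s m (fun r => k r b) + t * jensenDefect s m (fun _ => 1) := by
        rw [Finset.sum_add_distrib, ← Finset.mul_sum, ← Finset.mul_sum, hpoint]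
    _ ≤ ∑ b, jensenDefect s m (fun r => k r b) := by nlinarith

end Kernel

section Channel

variable {n : ℕ} {X0A YdA : Type} {XA YA YhA : Fin n → Type}

/-- Isolating the compression variable of relay `i` in the sample space. -/
def splitYh (i : Fin n) : CFOmega X0A XA YA YdA YhA ≃
    (X0A × (∀ i, XA i) × (∀ i, YA i) × YdA × (∀ j : {j // j ≠ i}, YhA j)) × YhA i where
  toFun ω := ((ω.1, ω.2.1, ω.2.2.1, ω.2.2.2.1, fun j => ω.2.2.2.2 j), ω.2.2.2.2 i)
  invFun p := (p.1.1, p.1.2.1, p.1.2.2.1, p.1.2.2.2.1,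
    (Equiv.piSplitAt i YhA).symm (p.2, p.1.2.2.2.2))
  left_inv ω := by
    have h := (Equiv.piSplitAt i YhA).symm_apply_apply ω.2.2.2.2
    exact Prod.ext rfl (Prod.ext rfl (Prod.ext rfl (Prod.ext rfl h)))
  right_inv p := by
    have h := (Equiv.piSplitAt i YhA).apply_symm_apply (p.2, p.1.2.2.2.2)
    have h1 := congrArg Prod.fst h
    have h2 := congrArg Prod.snd h
    exact Prod.ext (Prod.ext rfl (Prod.ext rfl (Prod.ext rfl (Prod.ext rfl h2)))) h1

/-- A random variable that does not depend on the compression of relay `i`. -/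
def IgnoresYh (i : Fin n) {α : Type*} (V : CFOmega X0A XA YA YdA YhA → α) : Prop :=
  ∀ r b b', V ((splitYh i).symm (r, b)) = V ((splitYh i).symm (r, b'))

theorem splitYh_symm_yh_ne {i j : Fin n} (hj : j ≠ i)
    (r : X0A × (∀ i, XA i) × (∀ i, YA i) × YdA × (∀ j : {j // j ≠ i}, YhA j)) (b : YhA i) :
    ((splitYh i).symm (r, b)).2.2.2.2 j = r.2.2.2.2 ⟨j, hj⟩ := by
  simp [splitYh, Equiv.piSplitAt, hj]

theorem splitYh_symm_yh_self (i : Fin n)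
    (r : X0A × (∀ i, XA i) × (∀ i, YA i) × YdA × (∀ j : {j // j ≠ i}, YhA j)) (b : YhA i) :
    ((splitYh i).symm (r, b)).2.2.2.2 i = b := by
  simp [splitYh, Equiv.piSplitAt]

theorem ignoresYh_rvYhS {i : Fin n} {S : Finset (Fin n)} (hi : i ∉ S) :
    IgnoresYh i (rvYhS S : CFOmega X0A XA YA YdA YhA → _) := by
  intro r b b'
  funext j
  have hj : (j : Fin n) ≠ i := fun h => hi (h ▸ j.2)
  simp only [rvYhS, splitYh_symm_yh_ne hj]

theorem IgnoresYh.prodMk {i : Fin n} {α β : Type*} {V : CFOmega X0A XA YA YdA YhA → α}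
    {V' : CFOmega X0A XA YA YdA YhA → β} (h : IgnoresYh i V) (h' : IgnoresYh i V') :
    IgnoresYh i (fun ω => (V ω, V' ω)) :=
  fun r b b' => Prod.ext (h r b b') (h' r b b')

theorem ignoresYh_of_fst (i : Fin n) {α : Type*}
    (f : X0A → (∀ i, XA i) → (∀ i, YA i) → YdA → α) :
    IgnoresYh i (fun ω : CFOmega X0A XA YA YdA YhA => f ω.1 ω.2.1 ω.2.2.1 ω.2.2.2.1) :=
  fun _ _ _ => rfl

/-- The part of the joint pmf not involving the compression kernel of relay `i`. -/
noncomputable def baseWeight (p0 : X0A → ℝ) (pX : ∀ i, XA i → ℝ)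
    (W : X0A → (∀ i, XA i) → ((∀ i, YA i) × YdA) → ℝ)
    (κ : ∀ i, YA i → XA i → YhA i → ℝ) (i : Fin n)
    (r : X0A × (∀ i, XA i) × (∀ i, YA i) × YdA × (∀ j : {j // j ≠ i}, YhA j)) : ℝ :=
  p0 r.1 * (∏ i, pX i (r.2.1 i)) * W r.1 r.2.1 (r.2.2.1, r.2.2.2.1)
    * ∏ j : {j // j ≠ i}, κ j (r.2.2.1 j) (r.2.1 j) (r.2.2.2.2 j)

/-- The compression kernel of relay `i`, as a kernel from the remaining variables. -/
def relayKernel (κ : ∀ i, YA i → XA i → YhA i → ℝ) (i : Fin n)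
    (r : X0A × (∀ i, XA i) × (∀ i, YA i) × YdA × (∀ j : {j // j ≠ i}, YhA j)) (b : YhA i) : ℝ :=
  κ i (r.2.2.1 i) (r.2.1 i) b

variable (p0 : X0A → ℝ) (pX : ∀ i, XA i → ℝ)
  (W : X0A → (∀ i, XA i) → ((∀ i, YA i) × YdA) → ℝ)

theorem muCF_splitYh (κ : ∀ i, YA i → XA i → YhA i → ℝ) (i : Fin n) :
    (fun p => muCF p0 pX W κ ((splitYh i).symm p))
      = fun p => baseWeight p0 pX W κ i p.1 * relayKernel κ i p.1 p.2 := by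
  funext p
  obtain ⟨r, b⟩ := p
  rw [muCF, Fintype.prod_eq_mul_prod_subtype_ne (fun j => κ j _ _ _) i, splitYh_symm_yh_self]
  have h : ∀ j : {j // j ≠ i}, ((splitYh i).symm (r, b)).2.2.2.2 j.1 = r.2.2.2.2 j :=
    fun j => splitYh_symm_yh_ne j.2 r b
  simp only [h]
  simp only [baseWeight, relayKernel, splitYh, Equiv.coe_fn_symm_mk]
  ring

theorem baseWeight_update (κ : ∀ i, YA i → XA i → YhA i → ℝ) (i : Fin n)
    (k : YA i → XA i → YhA i → ℝ) :
    baseWeight (YdA := YdA) p0 pX W (Function.update κ i k) i = baseWeight p0 pX W κ i := by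
  funext r
  simp only [baseWeight]
  congr 1
  refine Finset.prod_congr rfl fun j _ => ?_
  rw [Function.update_of_ne j.2]

variable [Fintype X0A] [Fintype YdA] [∀ i, Fintype (XA i)] [∀ i, Fintype (YA i)]
  [∀ i, Fintype (YhA i)]

theorem entropy_muCF_of_ignoresYh [∀ i, Nonempty (YhA i)] {α : Type*} [Fintype α] [DecidableEq α]
    {κ : ∀ i, YA i → XA i → YhA i → ℝ} {i : Fin n} (hκ : ∀ y x, ∑ b, κ i y x b = 1)
    {V : CFOmega X0A XA YA YdA YhA → α} (hV : IgnoresYh i V) :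
    entropy (muCF p0 pX W κ) V
      = entropy (baseWeight p0 pX W κ i)
        (fun r => V ((splitYh i).symm (r, Classical.arbitrary _))) := by
  rw [entropy_comp_equiv (splitYh i), muCF_splitYh]
  have h : (fun p => V ((splitYh i).symm p))
      = fun p => V ((splitYh i).symm (p.1, Classical.arbitrary _)) := by
    funext p
    exact hV p.1 p.2 _
  rw [h]
  exact entropy_marginal (baseWeight p0 pX W κ i) (relayKernel κ i)
    (fun r => V ((splitYh i).symm (r, Classical.arbitrary _))) (fun r => hκ _ _)

theorem entropy_muCF_update [∀ i, Nonempty (YhA i)] {α : Type*} [Fintype α] [DecidableEq α]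
    {κ : ∀ i, YA i → XA i → YhA i → ℝ} {i : Fin n} (hκ : ∀ y x, ∑ b, κ i y x b = 1)
    {k : YA i → XA i → YhA i → ℝ} (hk : ∀ y x, ∑ b, k y x b = 1)
    {V : CFOmega X0A XA YA YdA YhA → α} (hV : IgnoresYh i V) :
    entropy (muCF p0 pX W (Function.update κ i k)) V = entropy (muCF p0 pX W κ) V := by
  rw [entropy_muCF_of_ignoresYh p0 pX W hκ hV,
    entropy_muCF_of_ignoresYh p0 pX W (by simpa using hk) hV, baseWeight_update]

/-- The conditional entropy `H(Ŷᵢ | Xᵢ, Yᵢ)`. -/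
noncomputable def kernelEntropy (κ : ∀ i, YA i → XA i → YhA i → ℝ) (i : Fin n) : ℝ :=
  ∑ r, baseWeight (YdA := YdA) p0 pX W κ i r * ∑ b, Real.negMulLog (relayKernel κ i r b)

theorem entropy_muCF_chain [∀ i, Nonempty (YhA i)] [∀ i, DecidableEq (YhA i)] {α : Type*}
    [Fintype α] [DecidableEq α]
    {κ : ∀ i, YA i → XA i → YhA i → ℝ} {i : Fin n} (hκ : ∀ y x, ∑ b, κ i y x b = 1)
    {V : CFOmega X0A XA YA YdA YhA → α} (hV : IgnoresYh i V)
    (hdet : ∀ ω ω', V ω = V ω' → κ i (ω.2.2.1 i) (ω.2.1 i) = κ i (ω'.2.2.1 i) (ω'.2.1 i)) :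
    entropy (muCF p0 pX W κ) (fun ω => (ω.2.2.2.2 i, V ω))
      = entropy (muCF p0 pX W κ) V + kernelEntropy p0 pX W κ i := by
  rw [entropy_muCF_of_ignoresYh p0 pX W hκ hV, entropy_comp_equiv (splitYh i), muCF_splitYh]
  have h : (fun p => (((splitYh i).symm p).2.2.2.2 i, V ((splitYh i).symm p)))
      = fun p => (p.2, V ((splitYh i).symm (p.1, Classical.arbitrary _))) := by
    funext p
    exact Prod.ext (splitYh_symm_yh_self i p.1 p.2) (hV p.1 p.2 _)
  rw [h]
  exact entropy_kernel_chain (baseWeight p0 pX W κ i) (relayKernel κ i)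
    (fun r => V ((splitYh i).symm (r, Classical.arbitrary _))) (fun r => hκ _ _)
    (fun r r' hr => hdet _ _ hr)

theorem kernelEntropy_update_of_ne [∀ i, Nonempty (YhA i)] [∀ i, DecidableEq (XA i)]
    [∀ i, DecidableEq (YA i)] [∀ i, DecidableEq (YhA i)]
    {κ : ∀ i, YA i → XA i → YhA i → ℝ} (hκ : ∀ i y x, ∑ b, κ i y x b = 1)
    {i j : Fin n} (hij : j ≠ i) {k : YA i → XA i → YhA i → ℝ} (hk : ∀ y x, ∑ b, k y x b = 1) :
    kernelEntropy (YdA := YdA) p0 pX W (Function.update κ i k) j = kernelEntropy p0 pX W κ j := by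
  have hV : ∀ l, IgnoresYh l (fun ω : CFOmega X0A XA YA YdA YhA => (ω.2.1, ω.2.2.1)) :=
    fun l => ignoresYh_of_fst l fun _ x y _ => (x, y)
  have hdet : ∀ κ : ∀ i, YA i → XA i → YhA i → ℝ, ∀ ω ω' : CFOmega X0A XA YA YdA YhA,
      (ω.2.1, ω.2.2.1) = (ω'.2.1, ω'.2.2.1) →
        κ j (ω.2.2.1 j) (ω.2.1 j) = κ j (ω'.2.2.1 j) (ω'.2.1 j) := by
    intro κ ω ω' h
    rw [(Prod.mk.inj h).1, (Prod.mk.inj h).2]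
  have h1 := entropy_muCF_chain p0 pX W (hκ j) (hV j) (hdet κ)
  have h2 := entropy_muCF_chain p0 pX W (κ := Function.update κ i k)
    (by simpa only [Function.update_of_ne hij] using hκ j) (hV j) (hdet _)
  have hV' : IgnoresYh i
      (fun ω : CFOmega X0A XA YA YdA YhA => (ω.2.2.2.2 j, (ω.2.1, ω.2.2.1))) := by
    refine IgnoresYh.prodMk (fun r b b' => ?_) (hV i)
    rw [splitYh_symm_yh_ne hij, splitYh_symm_yh_ne hij]
  rw [entropy_muCF_update p0 pX W (hκ i) hk (hV i), entropy_muCF_update p0 pX W (hκ i) hk hV'] at h2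
  linarith

variable [∀ i, DecidableEq (YhA i)]

/-- Mixing the compression kernel of relay `i` with a point mass. -/
noncomputable def mixKernel (k : ∀ i, YA i → XA i → YhA i → ℝ) (i : Fin n) (c : YhA i) (t : ℝ) :
    ∀ i, YA i → XA i → YhA i → ℝ :=
  Function.update k i fun y x b => (1 - t) * k i y x b + t * if b = c then 1 else 0

theorem entropy_mixKernel_le [∀ i, Nonempty (YhA i)] (hp0 : ∀ x, 0 ≤ p0 x)
    (hpX : ∀ i x, 0 ≤ pX i x) (hW : ∀ x0 x y, 0 ≤ W x0 x y)
    {κ : ∀ i, YA i → XA i → YhA i → ℝ} (hκ0 : ∀ i y x b, 0 ≤ κ i y x b)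
    (hκ : ∀ i y x, ∑ b, κ i y x b = 1) (i : Fin n) (c : YhA i) {t : ℝ} (ht0 : 0 ≤ t)
    (ht1 : t ≤ 1) {α : Type*} [Fintype α] [DecidableEq α]
    {V : CFOmega X0A XA YA YdA YhA → α} (hV : IgnoresYh i V) :
    entropy (muCF p0 pX W (mixKernel κ i c t)) (fun ω => (ω.2.2.2.2 i, V ω))
        - kernelEntropy (YdA := YdA) p0 pX W (mixKernel κ i c t) i
      ≤ entropy (muCF p0 pX W κ) (fun ω => (ω.2.2.2.2 i, V ω))
        - kernelEntropy (YdA := YdA) p0 pX W κ i := by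
  rw [entropy_comp_equiv (splitYh i), entropy_comp_equiv (splitYh i), muCF_splitYh, muCF_splitYh]
  have h : (fun p => (((splitYh i).symm p).2.2.2.2 i, V ((splitYh i).symm p)))
      = fun p => (p.2, V ((splitYh i).symm (p.1, Classical.arbitrary _))) := by
    funext p
    exact Prod.ext (splitYh_symm_yh_self i p.1 p.2) (hV p.1 p.2 _)
  have hker : relayKernel (X0A := X0A) (YdA := YdA) (mixKernel κ i c t) i
      = fun r b => (1 - t) * relayKernel κ i r b + t * if b = c then 1 else 0 := by
    funext r b
    simp [relayKernel, mixKernel]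
  rw [h, kernelEntropy, kernelEntropy, hker, mixKernel, baseWeight_update]
  refine entropy_kernel_mix_le (baseWeight p0 pX W κ i) (relayKernel κ i)
    (fun r => V ((splitYh i).symm (r, Classical.arbitrary _))) (fun r => ?_)
    (fun r b => hκ0 _ _ _ _) (fun r => hκ _ _ _) c ht0 ht1
  exact mul_nonneg (mul_nonneg (mul_nonneg (hp0 _) (Finset.prod_nonneg fun _ _ => hpX _ _))
    (hW _ _ _)) (Finset.prod_nonneg fun _ _ => hκ0 _ _ _ _)

omit [Fintype X0A] [Fintype YdA] [∀ i, Fintype (XA i)] [∀ i, Fintype (YA i)]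
  [∀ i, Fintype (YhA i)] [∀ i, DecidableEq (YhA i)] in
theorem rvXS_eq_iff (S : Finset (Fin n)) (ω ω' : CFOmega X0A XA YA YdA YhA) :
    rvXS S ω = rvXS S ω' ↔ ∀ i ∈ S, ω.2.1 i = ω'.2.1 i := by
  simp [rvXS, funext_iff]

omit [Fintype X0A] [Fintype YdA] [∀ i, Fintype (XA i)] [∀ i, Fintype (YA i)]
  [∀ i, Fintype (YhA i)] [∀ i, DecidableEq (YhA i)] in
theorem rvYS_eq_iff (S : Finset (Fin n)) (ω ω' : CFOmega X0A XA YA YdA YhA) :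
    rvYS S ω = rvYS S ω' ↔ ∀ i ∈ S, ω.2.2.1 i = ω'.2.2.1 i := by
  simp [rvYS, funext_iff]

omit [Fintype X0A] [Fintype YdA] [∀ i, Fintype (XA i)] [∀ i, Fintype (YA i)]
  [∀ i, Fintype (YhA i)] [∀ i, DecidableEq (YhA i)] in
theorem rvYhS_eq_iff (S : Finset (Fin n)) (ω ω' : CFOmega X0A XA YA YdA YhA) :
    rvYhS S ω = rvYhS S ω' ↔ ∀ i ∈ S, ω.2.2.2.2 i = ω'.2.2.2.2 i := by
  simp [rvYhS, funext_iff]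

theorem entropy_muCF_chain_finset [∀ i, Nonempty (YhA i)] {α : Type*} [Fintype α]
    [DecidableEq α] {κ : ∀ i, YA i → XA i → YhA i → ℝ} (hκ : ∀ i y x, ∑ b, κ i y x b = 1)
    {U : CFOmega X0A XA YA YdA YhA → α} (hU : ∀ i, IgnoresYh i U) (A S : Finset (Fin n))
    (hAS : Disjoint A S)
    (hdet : ∀ i ∈ S, ∀ ω ω', U ω = U ω' → ω.2.2.1 i = ω'.2.2.1 i ∧ ω.2.1 i = ω'.2.1 i) :
    entropy (muCF p0 pX W κ) (fun ω => (U ω, rvYhS (A ∪ S) ω))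
      = entropy (muCF p0 pX W κ) (fun ω => (U ω, rvYhS A ω))
        + ∑ i ∈ S, kernelEntropy (YdA := YdA) p0 pX W κ i := by
  induction S using Finset.induction_on with
  | empty =>
    rw [Finset.sum_empty, add_zero, Finset.union_empty]
  | insert i S hi ih =>
    rw [Finset.disjoint_insert_right] at hAS
    have hiA : i ∉ A ∪ S := by simp [hi, hAS.1]
    have h := entropy_muCF_chain p0 pX W (hκ i) ((hU i).prodMk (ignoresYh_rvYhS hiA))
      (fun ω ω' h => by
        obtain ⟨h1, h2⟩ := hdet i (Finset.mem_insert_self i S) ω ω' (Prod.mk.inj h).1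
        rw [h1, h2])
    rw [Finset.sum_insert hi, add_left_comm,
      ← ih hAS.2 fun j hj => hdet j (Finset.mem_insert_of_mem hj), add_comm, ← h]
    refine entropy_congr _ fun ω ω' => ?_
    simp only [Prod.mk.injEq, rvYhS_eq_iff, Finset.union_insert, Finset.forall_mem_insert]
    tauto

variable [DecidableEq X0A] [DecidableEq YdA] [∀ i, DecidableEq (XA i)] [∀ i, DecidableEq (YA i)]

/-- The term of the joint-decoding rate `Gfun μ N` indexed by `S`. -/
noncomputable def jointTerm (μ : CFOmega X0A XA YA YdA YhA → ℝ) (S : Finset (Fin n)) : ℝ :=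
  condMI μ (fun ω => (rvX0 ω, rvXS S ω)) (fun ω => (rvYhS (Finset.univ \ S) ω, rvYd ω))
      (rvXS (Finset.univ \ S))
    - condMI μ (rvYS S) (rvYhS S)
      (fun ω => (rvX0 ω, rvXS (Finset.univ : Finset (Fin n)) ω, rvYd ω,
        rvYhS (Finset.univ \ S) ω))

/-- `H(X_A, Ŷ_A, Y_{n+1})`. -/
noncomputable def outputEntropy (μ : CFOmega X0A XA YA YdA YhA → ℝ) (A : Finset (Fin n)) : ℝ :=
  entropy μ (fun ω => (rvXS A ω, rvYhS A ω, rvYd ω))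

set_option synthInstance.maxHeartbeats 400000 in
set_option synthInstance.maxSize 2000 in
theorem jointTerm_muCF [∀ i, Nonempty (YhA i)] {κ : ∀ i, YA i → XA i → YhA i → ℝ}
    (hκ : ∀ i y x, ∑ b, κ i y x b = 1) (S : Finset (Fin n)) :
    jointTerm (YdA := YdA) (muCF p0 pX W κ) S
      = entropy (muCF (YdA := YdA) p0 pX W κ) (fun ω => (ω.1, ω.2.1))
        - entropy (muCF (YdA := YdA) p0 pX W κ) (fun ω => (ω.1, ω.2.1, ω.2.2.2.1, ω.2.2.2.2))
        + outputEntropy (muCF (YdA := YdA) p0 pX W κ) (Finset.univ \ S)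
        - entropy (muCF (YdA := YdA) p0 pX W κ) (rvXS (Finset.univ \ S))
        + ∑ i ∈ S, kernelEntropy (YdA := YdA) p0 pX W κ i := by
  set μ := muCF (YdA := YdA) p0 pX W κ
  have chain := entropy_muCF_chain_finset p0 pX W hκ
    (U := fun ω : CFOmega X0A XA YA YdA YhA => (ω.1, ω.2.1, ω.2.2.2.1, rvYS S ω))
    (fun i => ignoresYh_of_fst i fun x0 x y yd => (x0, x, yd, fun j : S => y j))
    (Finset.univ \ S) S Finset.sdiff_disjoint
    (fun i hi ω ω' h => by
      simp only [Prod.mk.injEq, rvYS_eq_iff] at h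
      exact ⟨h.2.2.2 i hi, by rw [h.2.1]⟩)
  have e1 : entropy μ (fun ω => ((rvX0 ω, rvXS S ω), rvXS (Finset.univ \ S) ω))
      = entropy μ (fun ω => (ω.1, ω.2.1)) := by
    refine entropy_congr _ fun ω ω' => ?_
    simp only [Prod.mk.injEq, rvXS_eq_iff, rvX0]
    simp only [funext_iff]
    grind
  have e2 : entropy μ (fun ω => ((rvYhS (Finset.univ \ S) ω, rvYd ω), rvXS (Finset.univ \ S) ω))
      = outputEntropy μ (Finset.univ \ S) := by
    refine entropy_congr _ fun ω ω' => ?_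
    simp only [Prod.mk.injEq]
    tauto
  have e3 : entropy μ (fun ω => ((rvX0 ω, rvXS S ω), (rvYhS (Finset.univ \ S) ω, rvYd ω),
        rvXS (Finset.univ \ S) ω))
      = entropy μ (fun ω => (rvX0 ω, rvXS (Finset.univ : Finset (Fin n)) ω, rvYd ω,
        rvYhS (Finset.univ \ S) ω)) := by
    refine entropy_congr _ fun ω ω' => ?_
    simp only [Prod.mk.injEq, rvXS_eq_iff, rvX0]
    grind
  have e4 : entropy μ (fun ω => (rvYS S ω, (rvX0 ω, rvXS (Finset.univ : Finset (Fin n)) ω, rvYd ω,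
        rvYhS (Finset.univ \ S) ω)))
      = entropy μ (fun ω => ((ω.1, ω.2.1, ω.2.2.2.1, rvYS S ω), rvYhS (Finset.univ \ S) ω)) := by
    refine entropy_congr _ fun ω ω' => ?_
    simp only [Prod.mk.injEq, rvXS_eq_iff, rvX0, rvYd]
    simp only [funext_iff]
    grind
  have e5 : entropy μ (fun ω => (rvYhS S ω, (rvX0 ω, rvXS (Finset.univ : Finset (Fin n)) ω,
        rvYd ω, rvYhS (Finset.univ \ S) ω)))
      = entropy μ (fun ω => (ω.1, ω.2.1, ω.2.2.2.1, ω.2.2.2.2)) := by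
    refine entropy_congr _ fun ω ω' => ?_
    simp only [Prod.mk.injEq, rvXS_eq_iff, rvYhS_eq_iff, rvX0, rvYd]
    simp only [funext_iff]
    grind
  have e6 : entropy μ (fun ω => (rvYS S ω, rvYhS S ω, (rvX0 ω,
        rvXS (Finset.univ : Finset (Fin n)) ω, rvYd ω, rvYhS (Finset.univ \ S) ω)))
      = entropy μ (fun ω => ((ω.1, ω.2.1, ω.2.2.2.1, rvYS S ω),
        rvYhS (Finset.univ \ S ∪ S) ω)) := by
    refine entropy_congr _ fun ω ω' => ?_
    simp only [Prod.mk.injEq, rvXS_eq_iff, rvYhS_eq_iff, rvX0, rvYd]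
    simp only [funext_iff]
    grind
  unfold jointTerm condMI
  rw [e1, e2, e3, e4, e5, e6]
  linarith

set_option synthInstance.maxHeartbeats 400000 in
set_option synthInstance.maxSize 2000 in
omit [DecidableEq X0A] in
theorem scGap_muCF [∀ i, Nonempty (YhA i)] {κ : ∀ i, YA i → XA i → YhA i → ℝ}
    (hκ : ∀ i y x, ∑ b, κ i y x b = 1) (S : Finset (Fin n)) :
    scGap (YdA := YdA) (muCF p0 pX W κ) S
      = entropy (muCF (YdA := YdA) p0 pX W κ) (rvXS (Finset.univ : Finset (Fin n)))
        - outputEntropy (muCF (YdA := YdA) p0 pX W κ) Finset.univ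
        + outputEntropy (muCF (YdA := YdA) p0 pX W κ) (Finset.univ \ S)
        - entropy (muCF (YdA := YdA) p0 pX W κ) (rvXS (Finset.univ \ S))
        + ∑ i ∈ S, kernelEntropy (YdA := YdA) p0 pX W κ i := by
  set μ := muCF (YdA := YdA) p0 pX W κ
  have chain := entropy_muCF_chain_finset p0 pX W hκ
    (U := fun ω : CFOmega X0A XA YA YdA YhA => (ω.2.1, ω.2.2.2.1, rvYS S ω))
    (fun i => ignoresYh_of_fst i fun _ x y yd => (x, yd, fun j : S => y j))
    (Finset.univ \ S) S Finset.sdiff_disjoint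
    (fun i hi ω ω' h => by
      simp only [Prod.mk.injEq, rvYS_eq_iff] at h
      exact ⟨h.2.2 i hi, by rw [h.1]⟩)
  have e1 : entropy μ (fun ω => (rvXS S ω, rvXS (Finset.univ \ S) ω))
      = entropy μ (rvXS (Finset.univ : Finset (Fin n))) := by
    refine entropy_congr _ fun ω ω' => ?_
    simp only [Prod.mk.injEq, rvXS_eq_iff]
    grind
  have e2 : entropy μ (fun ω => ((rvYhS (Finset.univ \ S) ω, rvYd ω), rvXS (Finset.univ \ S) ω))
      = outputEntropy μ (Finset.univ \ S) := by
    refine entropy_congr _ fun ω ω' => ?_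
    simp only [Prod.mk.injEq]
    tauto
  have e3 : entropy μ (fun ω => (rvXS S ω, (rvYhS (Finset.univ \ S) ω, rvYd ω),
        rvXS (Finset.univ \ S) ω))
      = entropy μ (fun ω => (rvXS (Finset.univ : Finset (Fin n)) ω, rvYd ω,
        rvYhS (Finset.univ \ S) ω)) := by
    refine entropy_congr _ fun ω ω' => ?_
    simp only [Prod.mk.injEq, rvXS_eq_iff]
    grind
  have e4 : entropy μ (fun ω => (rvYS S ω, (rvXS (Finset.univ : Finset (Fin n)) ω, rvYd ω,
        rvYhS (Finset.univ \ S) ω)))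
      = entropy μ (fun ω => ((ω.2.1, ω.2.2.2.1, rvYS S ω), rvYhS (Finset.univ \ S) ω)) := by
    refine entropy_congr _ fun ω ω' => ?_
    simp only [Prod.mk.injEq, rvXS_eq_iff, rvYd]
    simp only [funext_iff]
    grind
  have e5 : entropy μ (fun ω => (rvYhS S ω, (rvXS (Finset.univ : Finset (Fin n)) ω,
        rvYd ω, rvYhS (Finset.univ \ S) ω)))
      = outputEntropy μ Finset.univ := by
    refine entropy_congr _ fun ω ω' => ?_
    simp only [Prod.mk.injEq, rvXS_eq_iff, rvYhS_eq_iff]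
    grind
  have e6 : entropy μ (fun ω => (rvYS S ω, rvYhS S ω, (
        rvXS (Finset.univ : Finset (Fin n)) ω, rvYd ω, rvYhS (Finset.univ \ S) ω)))
      = entropy μ (fun ω => ((ω.2.1, ω.2.2.2.1, rvYS S ω),
        rvYhS (Finset.univ \ S ∪ S) ω)) := by
    refine entropy_congr _ fun ω ω' => ?_
    simp only [Prod.mk.injEq, rvXS_eq_iff, rvYhS_eq_iff, rvYd]
    simp only [funext_iff]
    grind
  unfold scGap condMI
  rw [e1, e2, e3, e4, e5, e6]
  linarith

/-- The rate `I(X_0; Ŷ_N, Y_{n+1} | X_N)` of successive decoding. -/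
noncomputable def successiveRate (μ : CFOmega X0A XA YA YdA YhA → ℝ) : ℝ :=
  condMI μ rvX0 (fun ω => (rvYhS (Finset.univ : Finset (Fin n)) ω, rvYd ω))
    (rvXS (Finset.univ : Finset (Fin n)))

omit [∀ i, DecidableEq (YA i)] in
theorem successiveRate_eq (μ : CFOmega X0A XA YA YdA YhA → ℝ) :
    successiveRate μ
      = entropy μ (fun ω => (ω.1, ω.2.1))
        - entropy μ (fun ω => (ω.1, ω.2.1, ω.2.2.2.1, ω.2.2.2.2))
        + outputEntropy μ Finset.univ - entropy μ (rvXS (Finset.univ : Finset (Fin n))) := by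
  have e1 : entropy μ (fun ω => (rvX0 ω, rvXS (Finset.univ : Finset (Fin n)) ω))
      = entropy μ (fun ω => (ω.1, ω.2.1)) := by
    refine entropy_congr _ fun ω ω' => ?_
    simp only [Prod.mk.injEq, rvXS_eq_iff, rvX0]
    simp [funext_iff]
  have e2 : entropy μ (fun ω => ((rvYhS (Finset.univ : Finset (Fin n)) ω, rvYd ω),
        rvXS (Finset.univ : Finset (Fin n)) ω))
      = outputEntropy μ Finset.univ := by
    refine entropy_congr _ fun ω ω' => ?_
    simp only [Prod.mk.injEq]
    tauto
  have e3 : entropy μ (fun ω => (rvX0 ω, (rvYhS (Finset.univ : Finset (Fin n)) ω, rvYd ω),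
        rvXS (Finset.univ : Finset (Fin n)) ω))
      = entropy μ (fun ω => (ω.1, ω.2.1, ω.2.2.2.1, ω.2.2.2.2)) := by
    refine entropy_congr _ fun ω ω' => ?_
    simp only [Prod.mk.injEq, rvXS_eq_iff, rvYhS_eq_iff, rvX0, rvYd]
    simp only [funext_iff]
    grind
  unfold successiveRate condMI
  rw [e1, e2, e3]
  ring

theorem jointTerm_eq_rate_add_gap [∀ i, Nonempty (YhA i)] {κ : ∀ i, YA i → XA i → YhA i → ℝ}
    (hκ : ∀ i y x, ∑ b, κ i y x b = 1) (S : Finset (Fin n)) :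
    jointTerm (YdA := YdA) (muCF p0 pX W κ) S
      = successiveRate (muCF p0 pX W κ) + scGap (muCF p0 pX W κ) S := by
  rw [jointTerm_muCF p0 pX W hκ, scGap_muCF p0 pX W hκ, successiveRate_eq]
  ring

theorem jointTerm_empty [∀ i, Nonempty (YhA i)] {κ : ∀ i, YA i → XA i → YhA i → ℝ}
    (hκ : ∀ i y x, ∑ b, κ i y x b = 1) :
    jointTerm (YdA := YdA) (muCF p0 pX W κ) ∅ = successiveRate (muCF p0 pX W κ) := by
  rw [jointTerm_muCF p0 pX W hκ, successiveRate_eq]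
  rw [Finset.sdiff_empty, Finset.sum_empty]
  ring

end Channel

section Optimization

open Filter Topology

/-- If, at each point and for each index, either removing that index from a set does not increase
the value, or there is a path decreasing `Φ` along which the terms containing the index do not
decrease, then a max-min point can be chosen at which the term of the empty set is minimal. -/
theorem exists_forall_empty_le {ι E : Type*} [Fintype ι] [DecidableEq ι] [TopologicalSpace E]
    {K : Set E} (hK : IsCompact K) {F : Finset ι → E → ℝ} (hF : ∀ S, Continuous (F S))
    {Φ : E → ℝ} (hΦ : Continuous Φ)
    (hsub : ∀ κ ∈ K, ∀ S T, F (S ∪ T) κ + F (S ∩ T) κ ≤ F S κ + F T κ)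
    (hmove : ∀ κ ∈ K, ∀ i, (∀ T, i ∈ T → F (T.erase i) κ ≤ F T κ) ∨
      ∃ γ : ℝ → E, Continuous γ ∧ γ 0 = κ ∧ ∀ t, 0 < t → t ≤ 1 →
        γ t ∈ K ∧ Φ (γ t) < Φ κ ∧ ∀ S, i ∈ S → F S κ ≤ F S (γ t))
    {κ : E} (hκ : κ ∈ K) :
    ∃ κ' ∈ K, (∀ S, F ∅ κ' ≤ F S κ') ∧ ∃ S, F S κ ≤ F ∅ κ' := by
  set m : E → ℝ := fun κ => Finset.univ.inf' Finset.univ_nonempty fun S => F S κ with hm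
  have hmc : Continuous m := Continuous.finset_inf'_apply _ fun S _ => hF S
  have hmle : ∀ κ S, m κ ≤ F S κ := fun κ S => Finset.inf'_le _ (Finset.mem_univ S)
  have hmex : ∀ κ, ∃ S, m κ = F S κ := fun κ => by
    obtain ⟨S, -, hS⟩ := Finset.exists_mem_eq_inf' Finset.univ_nonempty fun S => F S κ
    exact ⟨S, hS⟩
  obtain ⟨κ₁, hκ₁, hmax⟩ := hK.exists_isMaxOn ⟨κ, hκ⟩ hmc.continuousOn
  have hK' : IsCompact (K ∩ {κ | m κ₁ ≤ m κ}) :=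
    hK.inter_right (isClosed_le continuous_const hmc)
  obtain ⟨κ₀, ⟨hκ₀, hκ₀m⟩, hmin⟩ := hK'.exists_isMinOn ⟨κ₁, hκ₁, le_refl (m κ₁)⟩ hΦ.continuousOn
  change m κ₁ ≤ m κ₀ at hκ₀m
  have hempty : ∀ S, F ∅ κ₀ ≤ F S κ₀ := by
    obtain ⟨T, hT, hTmin⟩ := Finset.exists_min_image
      (Finset.univ.filter fun S => F S κ₀ = m κ₀) Finset.card
      (by obtain ⟨S, hS⟩ := hmex κ₀; exact ⟨S, by simp [hS]⟩)
    simp only [Finset.mem_filter, Finset.mem_univ, true_and] at hT hTmin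
    rcases T.eq_empty_or_nonempty with rfl | ⟨i, hi⟩
    · intro S
      rw [hT]
      exact hmle κ₀ S
    exfalso
    have hmem : ∀ S, F S κ₀ = m κ₀ → i ∈ S := by
      intro S hS
      have h1 := hsub κ₀ hκ₀ S T
      have h2 : F (S ∩ T) κ₀ = m κ₀ :=
        le_antisymm (by linarith [hmle κ₀ (S ∪ T)]) (hmle κ₀ _)
      have h3 := Finset.eq_of_subset_of_card_le Finset.inter_subset_right (hTmin _ h2)
      rw [← h3] at hi
      exact (Finset.mem_inter.1 hi).1
    rcases hmove κ₀ hκ₀ i with hrem | ⟨γ, hγ, hγ0, hγK⟩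
    · have h := hTmin (T.erase i) (le_antisymm (hT ▸ hrem T hi) (hmle κ₀ _))
      exact absurd (Finset.card_erase_lt_of_mem hi) (not_lt.2 h)
    · have hev : ∀ᶠ t in 𝓝[>] (0 : ℝ), ∀ S, i ∉ S → m κ₀ < F S (γ t) := by
        refine eventually_all.2 fun S => ?_
        by_cases hS : i ∈ S
        · exact Eventually.of_forall fun t h => absurd hS h
        · have hlt : m κ₀ < F S (γ 0) := by
            rw [hγ0]
            exact lt_of_le_of_ne (hmle κ₀ S) fun h => hS (hmem S h.symm)
          have := ((hF S).comp hγ).continuousAt.eventually_const_lt hlt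
          exact (this.filter_mono nhdsWithin_le_nhds).mono fun t ht _ => ht
      obtain ⟨t, ht, ht0, ht1⟩ := (hev.and (Ioc_mem_nhdsGT (zero_lt_one' ℝ))).exists
      obtain ⟨hK1, hΦ1, hF1⟩ := hγK t ht0 ht1
      have hge : m κ₀ ≤ m (γ t) := by
        refine Finset.le_inf' _ _ fun S _ => ?_
        by_cases hS : i ∈ S
        · exact (hmle κ₀ S).trans (hF1 S hS)
        · exact (ht S hS).le
      exact absurd (hmin ⟨hK1, hκ₀m.trans hge⟩) (not_le.2 hΦ1)
  obtain ⟨S, hS⟩ := hmex κ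
  obtain ⟨S₀, hS₀⟩ := hmex κ₀
  refine ⟨κ₀, hκ₀, hempty, S, ?_⟩
  have h1 : m κ ≤ m κ₁ := hmax hκ
  linarith [hmle κ₀ ∅]

end Optimization

section ProductLaw

variable {n : ℕ} {XA : Fin n → Type} [∀ i, Fintype (XA i)] [∀ i, DecidableEq (XA i)]

omit [∀ i, DecidableEq (XA i)] in
theorem sum_pi_prod_eq_one {f : ∀ i, XA i → ℝ} (hf : ∀ i, ∑ x, f i x = 1) :
    ∑ x : ∀ i, XA i, ∏ i, f i (x i) = 1 := by
  rw [← Fintype.piFinset_univ, ← Finset.prod_univ_sum]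
  simp [hf]

/-- The entropy of a family of independent variables is modular. -/
theorem exists_entropy_pi_insert {f : ∀ i, XA i → ℝ} (hf : ∀ i, ∑ x, f i x = 1) :
    ∃ d : Fin n → ℝ, ∀ (A : Finset (Fin n)) (i : Fin n), i ∉ A →
      entropy (fun x : ∀ i, XA i => ∏ i, f i (x i)) (fun x (j : ↥(insert i A)) => x j)
        = entropy (fun x : ∀ i, XA i => ∏ i, f i (x i)) (fun x (j : A) => x j) + d i := by
  refine ⟨fun i => ∑ r : ∀ j : {j // j ≠ i}, XA j, (∏ j : {j // j ≠ i}, f j (r j))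
    * ∑ b, Real.negMulLog (f i b), fun A i hi => ?_⟩
  let e : (∀ i, XA i) ≃ (∀ j : {j // j ≠ i}, XA j) × XA i :=
    (Equiv.piSplitAt i XA).trans (Equiv.prodComm _ _)
  have hne : ∀ j : A, (j : Fin n) ≠ i := fun j h => hi (h ▸ j.2)
  have hself : ∀ p, e.symm p i = p.2 := fun p => by simp [e, Equiv.piSplitAt]
  have hother : ∀ p (j : {j // j ≠ i}), e.symm p j = p.1 j := fun p j => by
    simp [e, Equiv.piSplitAt, j.2]
  have hm : (fun p => ∏ j, f j (e.symm p j))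
      = fun p => (∏ j : {j // j ≠ i}, f j (p.1 j)) * f i p.2 := by
    funext p
    rw [Fintype.prod_eq_mul_prod_subtype_ne (fun j => f j _) i, hself, mul_comm]
    simp only [hother]
  have hA : entropy (fun x : ∀ i, XA i => ∏ i, f i (x i)) (fun x (j : A) => x j)
      = entropy (fun r : ∀ j : {j // j ≠ i}, XA j => ∏ j : {j // j ≠ i}, f j (r j))
        (fun r (j : A) => r ⟨j, hne j⟩) := by
    have hv : (fun p (j : A) => e.symm p j) = fun p (j : A) => p.1 ⟨j, hne j⟩ :=
      funext fun p => funext fun j => hother p ⟨j, hne j⟩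
    rw [entropy_comp_equiv e, hm, hv]
    exact entropy_marginal (fun r : ∀ j : {j // j ≠ i}, XA j => ∏ j : {j // j ≠ i}, f j (r j))
      (fun _ => f i) (fun r (j : A) => r ⟨j, hne j⟩) (fun _ => hf i)
  have hins : entropy (fun x : ∀ i, XA i => ∏ i, f i (x i)) (fun x (j : ↥(insert i A)) => x j)
      = entropy (fun x : ∀ i, XA i => ∏ i, f i (x i)) (fun x => (x i, fun j : A => x j)) := by
    refine entropy_congr _ fun x x' => ?_
    simp [funext_iff]
  have hv : (fun p => (e.symm p i, fun j : A => e.symm p j))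
      = fun p => (p.2, fun j : A => p.1 ⟨j, hne j⟩) :=
    funext fun p => Prod.ext (hself p) (funext fun j => hother p ⟨j, hne j⟩)
  rw [hA, hins, entropy_comp_equiv e, hm, hv]
  exact entropy_kernel_chain (fun r : ∀ j : {j // j ≠ i}, XA j => ∏ j : {j // j ≠ i}, f j (r j))
    (fun _ => f i) (fun r (j : A) => r ⟨j, hne j⟩) (fun _ => hf i) (fun _ _ _ => rfl)

end ProductLaw

section Channel

variable {n : ℕ} {X0A YdA : Type} {XA YA YhA : Fin n → Type}
  [Fintype X0A] [Fintype YdA] [∀ i, Fintype (XA i)] [∀ i, Fintype (YA i)]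
  [∀ i, Fintype (YhA i)] [DecidableEq X0A] [DecidableEq YdA] [∀ i, DecidableEq (XA i)]
  [∀ i, DecidableEq (YA i)] [∀ i, DecidableEq (YhA i)]
  {p0 : X0A → ℝ} {pX : ∀ i, XA i → ℝ} {W : X0A → (∀ i, XA i) → ((∀ i, YA i) × YdA) → ℝ}

omit [DecidableEq X0A] [DecidableEq YdA] [∀ i, DecidableEq (YA i)] [∀ i, DecidableEq (YhA i)] in
theorem entropy_rvXS (hp0 : ∑ x, p0 x = 1) (hW : ∀ x0 x, ∑ y, W x0 x y = 1)
    {κ : ∀ i, YA i → XA i → YhA i → ℝ} (hκ : ∀ i y x, ∑ b, κ i y x b = 1) (A : Finset (Fin n)) :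
    entropy (muCF p0 pX W κ) (rvXS A)
      = entropy (fun x : ∀ i, XA i => ∏ i, pX i (x i)) (fun x (j : A) => x j) := by
  let e : CFOmega X0A XA YA YdA YhA ≃ (∀ i, XA i) × (X0A × ((∀ i, YA i) × YdA) × (∀ i, YhA i)) :=
    { toFun := fun ω => (ω.2.1, ω.1, (ω.2.2.1, ω.2.2.2.1), ω.2.2.2.2)
      invFun := fun p => (p.2.1, p.1, p.2.2.1.1, p.2.2.1.2, p.2.2.2)
      left_inv := fun _ => rfl
      right_inv := fun _ => rfl }
  let k : (∀ i, XA i) → X0A × ((∀ i, YA i) × YdA) × (∀ i, YhA i) → ℝ := fun x q =>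
    p0 q.1 * (W q.1 x q.2.1 * ∏ i, κ i (q.2.1.1 i) (x i) (q.2.2 i))
  have hm : (fun p => muCF p0 pX W κ (e.symm p)) = fun p => (∏ i, pX i (p.1 i)) * k p.1 p.2 := by
    funext p
    simp only [muCF, e, k, Equiv.coe_fn_symm_mk]
    ring
  have hv : (fun p => rvXS A (e.symm p)) = fun p (j : A) => p.1 j := rfl
  have hk : ∀ x, ∑ q, k x q = 1 := fun x => by
    have h1 : ∀ y : ∀ i, YA i, ∑ b : ∀ i, YhA i, ∏ i, κ i (y i) (x i) (b i) = 1 :=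
      fun y => sum_pi_prod_eq_one fun i => hκ i (y i) (x i)
    calc ∑ q, k x q = ∑ x0, ∑ q : ((∀ i, YA i) × YdA) × (∀ i, YhA i),
          p0 x0 * (W x0 x q.1 * ∏ i, κ i (q.1.1 i) (x i) (q.2 i)) := Fintype.sum_prod_type _
      _ = ∑ x0, ∑ y : (∀ i, YA i) × YdA, ∑ b : ∀ i, YhA i,
          p0 x0 * (W x0 x y * ∏ i, κ i (y.1 i) (x i) (b i)) :=
        Finset.sum_congr rfl fun x0 _ => Fintype.sum_prod_type _
      _ = 1 := by simp only [← Finset.mul_sum, h1, hW, hp0, mul_one]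
  rw [entropy_comp_equiv e, hm, hv]
  exact entropy_marginal (fun x : ∀ i, XA i => ∏ i, pX i (x i)) k (fun x (j : A) => x j) hk

omit [Fintype X0A] [Fintype YdA] [∀ i, Fintype (XA i)] [∀ i, Fintype (YA i)]
  [∀ i, Fintype (YhA i)] [DecidableEq X0A] [DecidableEq YdA] [∀ i, DecidableEq (XA i)]
  [∀ i, DecidableEq (YA i)] [∀ i, DecidableEq (YhA i)] in
theorem muCF_nonneg (hp0 : ∀ x, 0 ≤ p0 x) (hpX : ∀ i x, 0 ≤ pX i x)
    (hW : ∀ x0 x y, 0 ≤ W x0 x y) {κ : ∀ i, YA i → XA i → YhA i → ℝ}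
    (hκ : ∀ i y x b, 0 ≤ κ i y x b) (ω : CFOmega X0A XA YA YdA YhA) :
    0 ≤ muCF p0 pX W κ ω :=
  mul_nonneg (mul_nonneg (mul_nonneg (hp0 _) (Finset.prod_nonneg fun _ _ => hpX _ _))
    (hW _ _ _)) (Finset.prod_nonneg fun _ _ => hκ _ _ _ _)

omit [DecidableEq X0A] [DecidableEq YdA] [∀ i, DecidableEq (YA i)] [∀ i, DecidableEq (YhA i)] in
theorem exists_entropy_rvXS_eq_sum (hp0 : ∑ x, p0 x = 1) (hpX : ∀ i, ∑ x, pX i x = 1)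
    (hW : ∀ x0 x, ∑ y, W x0 x y = 1) {κ : ∀ i, YA i → XA i → YhA i → ℝ}
    (hκ : ∀ i y x, ∑ b, κ i y x b = 1) :
    ∃ (c : ℝ) (d : Fin n → ℝ), ∀ A : Finset (Fin n),
      entropy (muCF p0 pX W κ) (rvXS A) = c + ∑ i ∈ A, d i := by
  obtain ⟨d, hd⟩ := exists_entropy_pi_insert hpX
  refine ⟨entropy (muCF p0 pX W κ) (rvXS ∅), d, fun A => ?_⟩
  induction A using Finset.induction_on with
  | empty => simp
  | insert i A hi ih =>
    rw [Finset.sum_insert hi, entropy_rvXS hp0 hW hκ, hd A i hi, ← entropy_rvXS hp0 hW hκ, ih]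
    ring

set_option synthInstance.maxHeartbeats 400000 in
set_option synthInstance.maxSize 2000 in
omit [DecidableEq X0A] [∀ i, DecidableEq (YA i)] in
theorem outputEntropy_submodular {μ : CFOmega X0A XA YA YdA YhA → ℝ} (hμ : ∀ ω, 0 ≤ μ ω)
    (A B : Finset (Fin n)) :
    outputEntropy μ (A ∩ B) + outputEntropy μ (A ∪ B) ≤ outputEntropy μ A + outputEntropy μ B := by
  have h := condMI_nonneg hμ (fun ω => (rvXS A ω, rvYhS A ω)) (fun ω => (rvXS B ω, rvYhS B ω))
    (fun ω => (rvXS (A ∩ B) ω, rvYhS (A ∩ B) ω, rvYd ω))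
  have e1 : entropy μ (fun ω => ((rvXS A ω, rvYhS A ω),
      (rvXS (A ∩ B) ω, rvYhS (A ∩ B) ω, rvYd ω))) = outputEntropy μ A := by
    refine entropy_congr _ fun ω ω' => ?_
    simp only [Prod.mk.injEq, rvXS_eq_iff, rvYhS_eq_iff]
    grind
  have e2 : entropy μ (fun ω => ((rvXS B ω, rvYhS B ω),
      (rvXS (A ∩ B) ω, rvYhS (A ∩ B) ω, rvYd ω))) = outputEntropy μ B := by
    refine entropy_congr _ fun ω ω' => ?_
    simp only [Prod.mk.injEq, rvXS_eq_iff, rvYhS_eq_iff]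
    grind
  have e3 : entropy μ (fun ω => ((rvXS A ω, rvYhS A ω), (rvXS B ω, rvYhS B ω),
      (rvXS (A ∩ B) ω, rvYhS (A ∩ B) ω, rvYd ω))) = outputEntropy μ (A ∪ B) := by
    refine entropy_congr _ fun ω ω' => ?_
    simp only [Prod.mk.injEq, rvXS_eq_iff, rvYhS_eq_iff]
    grind
  unfold condMI at h
  rw [e1, e2, e3] at h
  change 0 ≤ _ - outputEntropy μ (A ∩ B) at h
  linarith

theorem jointTerm_submodular [∀ i, Nonempty (YhA i)] (hp0 : ∀ x, 0 ≤ p0 x)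
    (hp0s : ∑ x, p0 x = 1) (hpX : ∀ i x, 0 ≤ pX i x) (hpXs : ∀ i, ∑ x, pX i x = 1)
    (hW : ∀ x0 x y, 0 ≤ W x0 x y) (hWs : ∀ x0 x, ∑ y, W x0 x y = 1)
    {κ : ∀ i, YA i → XA i → YhA i → ℝ} (hκ : ∀ i y x b, 0 ≤ κ i y x b)
    (hκs : ∀ i y x, ∑ b, κ i y x b = 1) (S T : Finset (Fin n)) :
    jointTerm (muCF p0 pX W κ) (S ∪ T) + jointTerm (muCF p0 pX W κ) (S ∩ T)
      ≤ jointTerm (muCF p0 pX W κ) S + jointTerm (muCF p0 pX W κ) T := by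
  obtain ⟨c, d, hd⟩ := exists_entropy_rvXS_eq_sum hp0s hpXs hWs hκs
  have h := outputEntropy_submodular (muCF_nonneg hp0 hpX hW hκ) (Finset.univ \ S) (Finset.univ \ T)
  have hk := Finset.sum_union_inter (s₁ := S) (s₂ := T)
    (f := kernelEntropy (YdA := YdA) p0 pX W κ)
  have hx := Finset.sum_union_inter (s₁ := Finset.univ \ S) (s₂ := Finset.univ \ T) (f := d)
  rw [jointTerm_muCF p0 pX W hκs, jointTerm_muCF p0 pX W hκs, jointTerm_muCF p0 pX W hκs,
    jointTerm_muCF p0 pX W hκs, hd, hd, hd, hd, Finset.sdiff_union_distrib,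
    Finset.sdiff_inter_distrib_right]
  linarith

theorem jointTerm_erase_le [∀ i, Nonempty (YhA i)] (hp0 : ∀ x, 0 ≤ p0 x)
    (hpX : ∀ i x, 0 ≤ pX i x) (hW : ∀ x0 x y, 0 ≤ W x0 x y)
    {κ : ∀ i, YA i → XA i → YhA i → ℝ} (hκ : ∀ i y x b, 0 ≤ κ i y x b)
    (hκs : ∀ i y x, ∑ b, κ i y x b = 1) {i : Fin n} (hc : ∀ y x y' x', κ i y x = κ i y' x')
    {T : Finset (Fin n)} (hi : i ∈ T) :
    jointTerm (muCF p0 pX W κ) (T.erase i) ≤ jointTerm (muCF p0 pX W κ) T := by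
  set μ := muCF p0 pX W κ with hμdef
  have hA : Finset.univ \ T.erase i = insert i (Finset.univ \ T) := by
    ext j
    by_cases h : j = i <;> simp [h]
  set A := Finset.univ \ T with hAdef
  have hiA : i ∉ A := by simp [hAdef, hi]
  have h := condMI_nonneg (muCF_nonneg hp0 hpX hW hκ) (rvXS (insert i A))
    (fun ω => (rvYhS A ω, rvYd ω)) (rvXS A)
  have hV : IgnoresYh i (fun ω : CFOmega X0A XA YA YdA YhA =>
      (rvXS (insert i A) ω, rvYhS A ω, rvYd ω)) :=
    IgnoresYh.prodMk (fun _ _ _ => rfl)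
      ((ignoresYh_rvYhS hiA).prodMk fun _ _ _ => rfl)
  have chain := entropy_muCF_chain p0 pX W (hκs i) hV fun ω ω' _ => hc _ _ _ _
  have e1 : entropy μ (fun ω => (rvXS (insert i A) ω, rvXS A ω))
      = entropy μ (rvXS (insert i A)) := by
    refine entropy_congr _ fun ω ω' => ?_
    simp only [Prod.mk.injEq, rvXS_eq_iff]
    grind
  have e2 : entropy μ (fun ω => ((rvYhS A ω, rvYd ω), rvXS A ω)) = outputEntropy μ A := by
    refine entropy_congr _ fun ω ω' => ?_
    simp only [Prod.mk.injEq]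
    tauto
  have e3 : entropy μ (fun ω => (rvXS (insert i A) ω, (rvYhS A ω, rvYd ω), rvXS A ω))
      = entropy μ (fun ω => (rvXS (insert i A) ω, rvYhS A ω, rvYd ω)) := by
    refine entropy_congr _ fun ω ω' => ?_
    simp only [Prod.mk.injEq, rvXS_eq_iff, rvYhS_eq_iff]
    grind
  have e4 : entropy μ (fun ω => (ω.2.2.2.2 i, (rvXS (insert i A) ω, rvYhS A ω, rvYd ω)))
      = outputEntropy μ (insert i A) := by
    refine entropy_congr _ fun ω ω' => ?_
    simp only [Prod.mk.injEq, rvXS_eq_iff, rvYhS_eq_iff]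
    grind
  unfold condMI at h
  rw [← hμdef] at h chain
  rw [e1, e2, e3] at h
  rw [e4] at chain
  rw [hμdef, jointTerm_muCF p0 pX W hκs, jointTerm_muCF p0 pX W hκs, hA, ← hAdef, ← hμdef,
    ← Finset.add_sum_erase T _ hi]
  linarith

omit [∀ i, DecidableEq (XA i)] [∀ i, DecidableEq (YA i)] [∀ i, Fintype (XA i)]
  [∀ i, Fintype (YA i)] in
theorem mixKernel_sum {κ : ∀ i, YA i → XA i → YhA i → ℝ} (hκs : ∀ i y x, ∑ b, κ i y x b = 1)
    (i : Fin n) (c : YhA i) (t : ℝ) (j : Fin n) (y : YA j) (x : XA j) :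
    ∑ b, mixKernel κ i c t j y x b = 1 := by
  by_cases h : j = i
  · subst h
    simp [mixKernel, Finset.sum_add_distrib, ← Finset.mul_sum, hκs]
  · simp [mixKernel, h, hκs]

omit [∀ i, DecidableEq (XA i)] [∀ i, DecidableEq (YA i)] [∀ i, Fintype (XA i)]
  [∀ i, Fintype (YA i)] [∀ i, Fintype (YhA i)] in
theorem mixKernel_nonneg {κ : ∀ i, YA i → XA i → YhA i → ℝ} (hκ : ∀ i y x b, 0 ≤ κ i y x b)
    (i : Fin n) (c : YhA i) {t : ℝ} (ht0 : 0 ≤ t) (ht1 : t ≤ 1) (j : Fin n) (y : YA j) (x : XA j)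
    (b : YhA j) : 0 ≤ mixKernel κ i c t j y x b := by
  by_cases h : j = i
  · subst h
    simp only [mixKernel, Function.update_self]
    have := mul_nonneg (sub_nonneg.2 ht1) (hκ j y x b)
    split_ifs <;> linarith
  · simp [mixKernel, h, hκ]

set_option synthInstance.maxHeartbeats 400000 in
set_option synthInstance.maxSize 2000 in
theorem jointTerm_le_mixKernel [∀ i, Nonempty (YhA i)] (hp0 : ∀ x, 0 ≤ p0 x)
    (hpX : ∀ i x, 0 ≤ pX i x) (hW : ∀ x0 x y, 0 ≤ W x0 x y)
    {κ : ∀ i, YA i → XA i → YhA i → ℝ} (hκ : ∀ i y x b, 0 ≤ κ i y x b)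
    (hκs : ∀ i y x, ∑ b, κ i y x b = 1) {i : Fin n} (c : YhA i) {t : ℝ} (ht0 : 0 ≤ t)
    (ht1 : t ≤ 1) {S : Finset (Fin n)} (hi : i ∈ S) :
    jointTerm (muCF p0 pX W κ) S ≤ jointTerm (muCF p0 pX W (mixKernel κ i c t)) S := by
  have hmix := mixKernel_sum hκs i c t
  have hup : ∀ y x, ∑ b, ((1 - t) * κ i y x b + t * if b = c then 1 else 0) = 1 := fun y x => by
    simpa [mixKernel] using hmix i y x
  have hiS : i ∉ Finset.univ \ S := by simp [hi]
  have h1 : entropy (muCF (YdA := YdA) p0 pX W (mixKernel κ i c t)) (fun ω => (ω.1, ω.2.1))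
      = entropy (muCF p0 pX W κ) (fun ω => (ω.1, ω.2.1)) :=
    entropy_muCF_update p0 pX W (hκs i) hup (ignoresYh_of_fst i fun x0 x _ _ => (x0, x))
  have h2 : outputEntropy (muCF (YdA := YdA) p0 pX W (mixKernel κ i c t)) (Finset.univ \ S)
      = outputEntropy (muCF p0 pX W κ) (Finset.univ \ S) :=
    entropy_muCF_update p0 pX W (hκs i) hup (IgnoresYh.prodMk (fun _ _ _ => rfl)
      ((ignoresYh_rvYhS hiS).prodMk fun _ _ _ => rfl))
  have h3 : entropy (muCF (YdA := YdA) p0 pX W (mixKernel κ i c t)) (rvXS (Finset.univ \ S))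
      = entropy (muCF p0 pX W κ) (rvXS (Finset.univ \ S)) :=
    entropy_muCF_update p0 pX W (hκs i) hup fun _ _ _ => rfl
  have h4 : ∑ j ∈ S.erase i, kernelEntropy (YdA := YdA) p0 pX W (mixKernel κ i c t) j
      = ∑ j ∈ S.erase i, kernelEntropy p0 pX W κ j :=
    Finset.sum_congr rfl fun j hj =>
      kernelEntropy_update_of_ne p0 pX W hκs (Finset.ne_of_mem_erase hj) hup
  have h5 := entropy_mixKernel_le p0 pX W hp0 hpX hW hκ hκs i c ht0 ht1
    (V := fun ω : CFOmega X0A XA YA YdA YhA =>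
      ((ω.1, ω.2.1, ω.2.2.2.1), rvYhS (Finset.univ.erase i) ω))
    ((ignoresYh_of_fst i fun x0 x _ yd => (x0, x, yd)).prodMk
      (ignoresYh_rvYhS (Finset.notMem_erase i _)))
  have h6 : ∀ μ : CFOmega X0A XA YA YdA YhA → ℝ,
      entropy μ (fun ω => (ω.2.2.2.2 i, ((ω.1, ω.2.1, ω.2.2.2.1), rvYhS (Finset.univ.erase i) ω)))
        = entropy μ (fun ω => (ω.1, ω.2.1, ω.2.2.2.1, ω.2.2.2.2)) := fun μ => by
    refine entropy_congr _ fun ω ω' => ?_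
    simp only [Prod.mk.injEq, rvYhS_eq_iff]
    simp only [funext_iff]
    grind
  rw [h6, h6] at h5
  rw [jointTerm_muCF p0 pX W hκs, jointTerm_muCF p0 pX W hmix, h1, h2, h3,
    ← Finset.add_sum_erase S _ hi, ← Finset.add_sum_erase S _ hi, h4]
  linarith

omit [DecidableEq X0A] [DecidableEq YdA] [∀ i, DecidableEq (XA i)] [∀ i, DecidableEq (YA i)]
  [∀ i, DecidableEq (YhA i)] in
theorem continuous_entropy_muCF {α : Type*} [Fintype α] [DecidableEq α]
    (V : CFOmega X0A XA YA YdA YhA → α) :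
    Continuous fun κ : ∀ i, YA i → XA i → YhA i → ℝ => entropy (muCF p0 pX W κ) V := by
  unfold entropy muCF
  refine continuous_finsetSum _ fun a _ => Real.continuous_negMulLog.comp ?_
  refine continuous_finsetSum _ fun ω _ => continuous_const.mul ?_
  refine continuous_finsetProd _ fun i _ => ?_
  fun_prop

set_option synthInstance.maxHeartbeats 400000 in
set_option synthInstance.maxSize 2000 in
theorem continuous_jointTerm_muCF (S : Finset (Fin n)) :
    Continuous fun κ : ∀ i, YA i → XA i → YhA i → ℝ => jointTerm (muCF p0 pX W κ) S := by
  unfold jointTerm condMI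
  exact ((((continuous_entropy_muCF _).add (continuous_entropy_muCF _)).sub
    (continuous_entropy_muCF _)).sub (continuous_entropy_muCF _)).sub
    ((((continuous_entropy_muCF _).add (continuous_entropy_muCF _)).sub
    (continuous_entropy_muCF _)).sub (continuous_entropy_muCF _))

end Channel

section Kernels

variable {n : ℕ} {X0A YdA : Type} {XA YA YhA : Fin n → Type}
  [Fintype X0A] [Fintype YdA] [∀ i, Fintype (XA i)] [∀ i, Fintype (YA i)]
  [∀ i, Fintype (YhA i)] [DecidableEq X0A] [DecidableEq YdA] [∀ i, DecidableEq (XA i)]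
  [∀ i, DecidableEq (YA i)] [∀ i, DecidableEq (YhA i)]

/-- The families of compression kernels. -/
def kernelSet (YA XA YhA : Fin n → Type) [∀ i, Fintype (YhA i)] :
    Set (∀ i, YA i → XA i → YhA i → ℝ) :=
  {κ | (∀ i y x b, 0 ≤ κ i y x b) ∧ ∀ i y x, ∑ b, κ i y x b = 1}

omit [∀ i, Fintype (XA i)] [∀ i, Fintype (YA i)] [∀ i, DecidableEq (XA i)]
  [∀ i, DecidableEq (YA i)] [∀ i, DecidableEq (YhA i)] in
theorem le_one_of_mem_kernelSet {κ : ∀ i, YA i → XA i → YhA i → ℝ}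
    (hκ : κ ∈ kernelSet YA XA YhA) (i : Fin n) (y : YA i) (x : XA i) (b : YhA i) :
    κ i y x b ≤ 1 := by
  rw [← hκ.2 i y x]
  exact Finset.single_le_sum (fun b _ => hκ.1 i y x b) (Finset.mem_univ b)

omit [∀ i, Fintype (XA i)] [∀ i, Fintype (YA i)] [∀ i, DecidableEq (XA i)]
  [∀ i, DecidableEq (YA i)] [∀ i, DecidableEq (YhA i)] in
theorem isCompact_kernelSet : IsCompact (kernelSet YA XA YhA) := by
  refine (isCompact_Icc (a := (0 : ∀ i, YA i → XA i → YhA i → ℝ)) (b := 1)).of_isClosed_subset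
    ?_ fun κ hκ => ⟨fun i y x b => hκ.1 i y x b,
      fun i y x b => le_one_of_mem_kernelSet hκ i y x b⟩
  refine IsClosed.and ?_ ?_
  · simp only [Set.ofPred_forall]
    exact isClosed_iInter fun i => isClosed_iInter fun y => isClosed_iInter fun x =>
      isClosed_iInter fun b => isClosed_le continuous_const (by fun_prop)
  · simp only [Set.ofPred_forall]
    exact isClosed_iInter fun i => isClosed_iInter fun y => isClosed_iInter fun x =>
      isClosed_eq (by fun_prop) continuous_const

omit [∀ i, Fintype (XA i)] [∀ i, Fintype (YA i)] [∀ i, Fintype (YhA i)] [∀ i, DecidableEq (XA i)]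
  [∀ i, DecidableEq (YA i)] in
theorem continuous_mixKernel (κ : ∀ i, YA i → XA i → YhA i → ℝ) (i : Fin n) (c : YhA i) :
    Continuous fun t => mixKernel κ i c t := by
  refine continuous_const.update i ?_
  fun_prop

omit [∀ i, Fintype (XA i)] [∀ i, Fintype (YA i)] [∀ i, Fintype (YhA i)] [∀ i, DecidableEq (XA i)]
  [∀ i, DecidableEq (YA i)] in
theorem mixKernel_zero (κ : ∀ i, YA i → XA i → YhA i → ℝ) (i : Fin n) (c : YhA i) :
    mixKernel κ i c 0 = κ := by
  simp [mixKernel]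

/-- The total mass put on the distinguished compression values. -/
noncomputable def pointMass (c : ∀ i, YhA i) (κ : ∀ i, YA i → XA i → YhA i → ℝ) : ℝ :=
  ∑ i, ∑ y, ∑ x, κ i y x (c i)

omit [∀ i, DecidableEq (XA i)] [∀ i, DecidableEq (YA i)] in
theorem pointMass_lt_mixKernel (c : ∀ i, YhA i) {κ : ∀ i, YA i → XA i → YhA i → ℝ}
    (hκ : κ ∈ kernelSet YA XA YhA) {i : Fin n} {y : YA i} {x : XA i} (h : κ i y x (c i) ≠ 1)
    {t : ℝ} (ht : 0 < t) :
    pointMass c κ < pointMass c (mixKernel κ i (c i) t) := by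
  have hle : ∀ j y x, κ j y x (c j) ≤ mixKernel κ i (c i) t j y x (c j) := by
    intro j y' x'
    by_cases hj : j = i
    · subst hj
      simp only [mixKernel, Function.update_self, if_true]
      nlinarith [mul_nonneg ht.le (sub_nonneg.2 (le_one_of_mem_kernelSet hκ j y' x' (c j)))]
    · simp [mixKernel, hj]
  have hlt : κ i y x (c i) < mixKernel κ i (c i) t i y x (c i) := by
    simp only [mixKernel, Function.update_self, if_true]
    nlinarith [lt_of_le_of_ne (le_one_of_mem_kernelSet hκ i y x (c i)) h]
  exact Finset.sum_lt_sum
    (fun j _ => Finset.sum_le_sum fun y _ => Finset.sum_le_sum fun x _ => hle j y x)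
    ⟨i, Finset.mem_univ i, Finset.sum_lt_sum
      (fun y _ => Finset.sum_le_sum fun x _ => hle i y x)
      ⟨y, Finset.mem_univ y, Finset.sum_lt_sum (fun x _ => hle i y x)
        ⟨x, Finset.mem_univ x, hlt⟩⟩⟩

omit [∀ i, Fintype (XA i)] [∀ i, Fintype (YA i)] [∀ i, DecidableEq (XA i)]
  [∀ i, DecidableEq (YA i)] in
theorem eq_point_of_mem_kernelSet {κ : ∀ i, YA i → XA i → YhA i → ℝ}
    (hκ : κ ∈ kernelSet YA XA YhA) {i : Fin n} {y : YA i} {x : XA i} {c : YhA i}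
    (h : κ i y x c = 1) : κ i y x = fun b => if b = c then 1 else 0 := by
  funext b
  by_cases hb : b = c
  · simp [hb, h]
  · have h1 := hκ.2 i y x
    rw [← Finset.add_sum_erase _ _ (Finset.mem_univ c), h, add_eq_left] at h1
    simpa [hb] using (Finset.sum_eq_zero_iff_of_nonneg fun b _ => hκ.1 i y x b).1 h1 b
      (by simp [hb])

theorem exists_scGap_nonneg [∀ i, Nonempty (YhA i)] {p0 : X0A → ℝ} {pX : ∀ i, XA i → ℝ}
    {W : X0A → (∀ i, XA i) → ((∀ i, YA i) × YdA) → ℝ} (hp0 : ∀ x, 0 ≤ p0 x)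
    (hp0s : ∑ x, p0 x = 1) (hpX : ∀ i x, 0 ≤ pX i x) (hpXs : ∀ i, ∑ x, pX i x = 1)
    (hW : ∀ x0 x y, 0 ≤ W x0 x y) (hWs : ∀ x0 x, ∑ y, W x0 x y = 1)
    {κ : ∀ i, YA i → XA i → YhA i → ℝ} (hκ : κ ∈ kernelSet YA XA YhA) :
    ∃ κ' ∈ kernelSet YA XA YhA, (∀ S, 0 ≤ scGap (muCF p0 pX W κ') S) ∧
      ∃ S, jointTerm (muCF p0 pX W κ) S ≤ successiveRate (muCF p0 pX W κ') := by
  let c : ∀ i, YhA i := fun i => Classical.arbitrary _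
  have hΦ : Continuous fun κ : ∀ i, YA i → XA i → YhA i → ℝ => -pointMass c κ := by
    unfold pointMass
    fun_prop
  obtain ⟨κ', hκ', hmin, S, hS⟩ := exists_forall_empty_le isCompact_kernelSet
    (F := fun S κ => jointTerm (muCF p0 pX W κ) S) continuous_jointTerm_muCF hΦ
    (fun κ hκ => jointTerm_submodular hp0 hp0s hpX hpXs hW hWs hκ.1 hκ.2)
    (fun κ hκ i => by
      by_cases h : ∀ y x, κ i y x (c i) = 1
      · exact Or.inl fun T => jointTerm_erase_le hp0 hpX hW hκ.1 hκ.2 fun y x y' x' => by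
          rw [eq_point_of_mem_kernelSet hκ (h y x), eq_point_of_mem_kernelSet hκ (h y' x')]
      · push Not at h
        obtain ⟨y, x, h⟩ := h
        exact Or.inr ⟨fun t => mixKernel κ i (c i) t, continuous_mixKernel κ i (c i),
          mixKernel_zero κ i (c i), fun t ht0 ht1 =>
            ⟨⟨mixKernel_nonneg hκ.1 i (c i) ht0.le ht1, mixKernel_sum hκ.2 i (c i) t⟩,
              neg_lt_neg (pointMass_lt_mixKernel c hκ h ht0),
              fun S hS => jointTerm_le_mixKernel hp0 hpX hW hκ.1 hκ.2 (c i) ht0.le ht1 hS⟩⟩) hκ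
  rw [jointTerm_empty p0 pX W hκ'.2] at hS
  refine ⟨κ', hκ', fun T => ?_, S, hS⟩
  have h := hmin T
  simp only [jointTerm_empty p0 pX W hκ'.2, jointTerm_eq_rate_add_gap p0 pX W hκ'.2] at h
  linarith

end Kernels

end CFRate

/-- For the multiple-relay channel with all relays performing
compress-and-forward, the noisy-network-coding/joint-decoding rate equals the
successive-decoding rate. -/
theorem joint_decoding_rate_eq_successive_decoding_rate
    {n : ℕ} {X0A YdA : Type} {XA YA YhA : Fin n → Type}
    [Fintype X0A] [DecidableEq X0A] [Fintype YdA] [DecidableEq YdA]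
    [∀ i, Fintype (XA i)] [∀ i, DecidableEq (XA i)]
    [∀ i, Fintype (YA i)] [∀ i, DecidableEq (YA i)]
    [∀ i, Fintype (YhA i)] [∀ i, DecidableEq (YhA i)]
    [Nonempty X0A] [Nonempty YdA] [∀ i, Nonempty (XA i)]
    [∀ i, Nonempty (YA i)] [∀ i, Nonempty (YhA i)]
    (W : X0A → (∀ i, XA i) → ((∀ i, YA i) × YdA) → ℝ)
    (hW : ∀ x0 x y, 0 ≤ W x0 x y) (hWs : ∀ x0 x, ∑ y, W x0 x y = 1) :
    sSup { r : ℝ | ∃ (p0 : X0A → ℝ) (pX : ∀ i, XA i → ℝ)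
        (κ : ∀ i, YA i → XA i → YhA i → ℝ),
        (∀ x, 0 ≤ p0 x) ∧ (∑ x, p0 x = 1) ∧
        (∀ i x, 0 ≤ pX i x) ∧ (∀ i, ∑ x, pX i x = 1) ∧
        (∀ i y x yh, 0 ≤ κ i y x yh) ∧ (∀ i y x, ∑ yh, κ i y x yh = 1) ∧
        r = Gfun (muCF p0 pX W κ) (Finset.univ : Finset (Fin n)) } =
    sSup { r : ℝ | ∃ (p0 : X0A → ℝ) (pX : ∀ i, XA i → ℝ)
        (κ : ∀ i, YA i → XA i → YhA i → ℝ),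
        (∀ x, 0 ≤ p0 x) ∧ (∑ x, p0 x = 1) ∧
        (∀ i x, 0 ≤ pX i x) ∧ (∀ i, ∑ x, pX i x = 1) ∧
        (∀ i y x yh, 0 ≤ κ i y x yh) ∧ (∀ i y x, ∑ yh, κ i y x yh = 1) ∧
        (∀ S : Finset (Fin n), 0 ≤ scGap (muCF p0 pX W κ) S) ∧
        r = condMI (muCF p0 pX W κ) rvX0
              (fun ω => (rvYhS (Finset.univ : Finset (Fin n)) ω, rvYd ω))
              (rvXS (Finset.univ : Finset (Fin n))) } := by
  refine csSup_eq_csSup_of_forall_exists_le ?_ ?_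
  · rintro r ⟨p0, pX, κ, hp0, hp0s, hpX, hpXs, hκ, hκs, rfl⟩
    obtain ⟨κ', hκ', hgap, S, hS⟩ :=
      CFRate.exists_scGap_nonneg hp0 hp0s hpX hpXs hW hWs (κ := κ) ⟨hκ, hκs⟩
    refine ⟨_, ⟨p0, pX, κ', hp0, hp0s, hpX, hpXs, hκ'.1, hκ'.2, hgap, rfl⟩, ?_⟩
    exact (Finset.inf'_le _ (Finset.mem_powerset.2 (Finset.subset_univ S))).trans hS
  · rintro r ⟨p0, pX, κ, hp0, hp0s, hpX, hpXs, hκ, hκs, hgap, rfl⟩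
    refine ⟨_, ⟨p0, pX, κ, hp0, hp0s, hpX, hpXs, hκ, hκs, rfl⟩, ?_⟩
    refine Finset.le_inf' _ _ fun S _ => ?_
    have h := CFRate.jointTerm_eq_rate_add_gap p0 pX W hκs S
    exact (le_add_of_nonneg_right (hgap S)).trans h.ge
end
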